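/- Assume B : (0,∞) → [0,∞) is continuous and bounded on some neighborhood of 0 and satisfies (A2), and let U be a continuously differentiable Perron eigenfunction. Then for every continuous f : (0,∞) → ℝ with f(x)/x → 0 as x → 0 and as x → ∞, the functions x ↦ (1/log 2) ∫_t^{t+log 2} e^{−s} M_s f(x) ds and x ↦ (1/t) ∫₀^t e^{−s} M_s f(x) ds both converge, locally uniformly on (0,∞) as t → ∞, to the function x ↦ (∫₀^∞ f(y) U(y) dy)·x. -/

import Mathlib

open MeasureTheory Real Set Filter Topology

noncomputable section

/-- A function on `(0,∞)` is locally bounded if it is bounded on the intersection of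
`(0,∞)` with every bounded set. -/
def LocBddOn (f : ℝ → ℝ) : Prop :=
  ∀ r > 0, ∃ C, ∀ x, 0 < x → x ≤ r → |f x| ≤ C

/-- A function on `[0,∞) × (0,∞)` is locally bounded if it is bounded on the intersection of
`[0,∞) × (0,∞)` with every bounded set. -/
def LocBdd2 (φ : ℝ → ℝ → ℝ) : Prop :=
  ∀ r > 0, ∃ C, ∀ t x, 0 ≤ t → t ≤ r → 0 < x → x ≤ r → |φ t x| ≤ C

/-- Mild solution of the dual mitosis equation with initial datum `f`. -/
def IsMildSol (B f : ℝ → ℝ) (φ : ℝ → ℝ → ℝ) : Prop :=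
  ∀ t ≥ 0, ∀ x > 0,
    φ t x = f (x * exp t) * Real.exp (-∫ s in (0:ℝ)..t, B (x * exp s))
      + 2 * ∫ τ in (0:ℝ)..t,
          B (x * exp τ) * Real.exp (-∫ s in (0:ℝ)..τ, B (x * exp s)) * φ (t - τ) (x * exp τ / 2)

/-- `B : (0,∞) → [0,∞)` is continuous and bounded on some neighborhood of `0`. -/
def Bhyp (B : ℝ → ℝ) : Prop :=
  ContinuousOn B (Ioi 0) ∧ (∀ x > 0, 0 ≤ B x) ∧
    ∃ ε > 0, ∃ C, ∀ x, 0 < x → x < ε → B x ≤ C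

/-- Assumption (A2) on the division rate: local integrability, support `[b,∞)`,
power-law bound near `0` and two-sided power-law bounds at infinity. -/
def HypA2 (B : ℝ → ℝ) : Prop :=
  (∀ a b : ℝ, 0 < a → IntegrableOn B (Icc a b)) ∧
  (∃ b ≥ (0:ℝ), closure {x : ℝ | 0 < x ∧ B x ≠ 0} = Ici b) ∧
  (∃ b₀ > (0:ℝ), ∃ γ₀ > (0:ℝ), ∃ K₀ > (0:ℝ), ∀ x, 0 < x → x < b₀ → B x ≤ K₀ * x ^ γ₀) ∧
  (∃ b₁ > (0:ℝ), ∃ γ₁ > (0:ℝ), ∃ γ₂ > (0:ℝ), ∃ K₁ > (0:ℝ), ∃ K₂ > (0:ℝ),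
    ∀ x, b₁ < x → K₁ * x ^ γ₁ ≤ B x ∧ B x ≤ K₂ * x ^ γ₂)

/-- `U` is a continuously differentiable Perron eigenfunction (with derivative `U'`):
nonnegative, solves `(xU)' + (B+1)U = 4B(2x)U(2x)`, is normalized by `∫ x U = 1`,
and `x^r U` is bounded and integrable on `(0,∞)` for every real `r`. -/
def Perron (B U U' : ℝ → ℝ) : Prop :=
  (∀ x > 0, 0 ≤ U x) ∧
  (∀ x > 0, HasDerivAt U (U' x) x) ∧
  ContinuousOn U' (Ioi 0) ∧
  (∀ x > 0, (U x + x * U' x) + (B x + 1) * U x = 4 * B (2 * x) * U (2 * x)) ∧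
  (∫ x in Ioi (0:ℝ), x * U x) = 1 ∧
  (∀ r : ℝ, (∃ C, ∀ x > 0, x ^ r * U x ≤ C) ∧ IntegrableOn (fun x => x ^ r * U x) (Ioi 0))

/-- swap for continuous integrands on rectangles -/
lemma swapc (F : ℝ → ℝ → ℝ) (hF : Continuous (Function.uncurry F)) (a b c d : ℝ) (hcd : c ≤ d) :
    ∫ x in a..b, ∫ y in c..d, F x y = ∫ y in c..d, ∫ x in a..b, F x y := by
  have : ∀ x, ∫ y in c..d, F x y = ∫ y in Ioc c d, F x y := fun x =>
    intervalIntegral.integral_of_le hcd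
  simp_rw [this]
  rw [intervalIntegral_integral_swap, intervalIntegral.integral_of_le hcd]
  rw [Measure.prod_restrict]
  have hc : IsCompact (uIcc a b ×ˢ Icc c d) := isCompact_uIcc.prod isCompact_Icc
  have := hF.continuousOn.integrableOn_compact (μ := (volume : Measure (ℝ × ℝ))) hc
  refine IntegrableOn.mono_set this ?_
  exact Set.prod_mono uIoc_subset_uIcc Ioc_subset_Icc_self

structure Sol (b : ℝ → ℝ) (L : ℝ) (h : ℝ → ℝ → ℝ) (C : ℝ) : Prop where
  cont : Continuous (Function.uncurry h)
  bdd : ∀ t z, |h t z| ≤ C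
  eq : ∀ t ≥ 0, ∀ s ≥ 0, ∀ y, h (t + s) (y - s) = h t y
    + ∫ r in (0:ℝ)..s, b (y - r) * (h (t + r) (y - r - L) - h (t + r) (y - r))

def avg (ε : ℝ) (h : ℝ → ℝ → ℝ) (t z : ℝ) : ℝ := (1 / ε) * ∫ s in (0:ℝ)..ε, h (t + s) z

lemma cont_comp {h : ℝ → ℝ → ℝ} (hc : Continuous (Function.uncurry h)) {X : Type*}
    [TopologicalSpace X] {p q : X → ℝ} (hp : Continuous p) (hq : Continuous q) :
    Continuous (fun x => h (p x) (q x)) := hc.comp (hp.prodMk hq)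

lemma avg_bdd {ε : ℝ} (hε : 0 < ε) {h : ℝ → ℝ → ℝ} {C : ℝ} (hb : ∀ t z, |h t z| ≤ C) (t z : ℝ) :
    |avg ε h t z| ≤ C := by
  unfold avg
  have := intervalIntegral.norm_integral_le_of_norm_le_const (a := 0) (b := ε) (C := C)
    (f := fun s => h (t + s) z) (fun x _ => hb _ _)
  rw [Real.norm_eq_abs, sub_zero, abs_of_pos hε] at this
  rw [abs_mul, abs_of_pos (by positivity : 0 < 1 / ε)]
  calc 1 / ε * _ ≤ 1 / ε * (C * ε) := by gcongr
    _ = C := by field_simp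

lemma avg_cont {ε : ℝ} {h : ℝ → ℝ → ℝ} (hc : Continuous (Function.uncurry h)) :
    Continuous (Function.uncurry (avg ε h)) := by
  unfold avg Function.uncurry
  refine continuous_const.mul ?_
  refine intervalIntegral.continuous_parametric_intervalIntegral_of_continuous'
    (f := fun (p : ℝ × ℝ) s => h (p.1 + s) p.2) ?_ 0 ε
  exact cont_comp hc (by fun_prop) (by fun_prop)

lemma Sol.avg {b : ℝ → ℝ} {L : ℝ} {h : ℝ → ℝ → ℝ} {C ε : ℝ} (hs : Sol b L h C)
    (hb : Continuous b) (hε : 0 < ε) : Sol b L (avg ε h) C := by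
  have hc := hs.cont
  refine ⟨avg_cont hs.cont, avg_bdd hε hs.bdd, fun t ht s hs0 y => ?_⟩
  unfold _root_.avg
  have e1 : ∀ r ∈ uIcc 0 ε, h (t + s + r) (y - s) = h (t + r) y
    + ∫ q in (0:ℝ)..s, b (y - q) * (h (t + r + q) (y - q - L) - h (t + r + q) (y - q)) := by
    intro r hr
    rw [uIcc_of_le hε.le] at hr
    rw [← hs.eq (t + r) (by linarith [hr.1]) s hs0 y]
    congr 1; ring
  have hF : Continuous (Function.uncurry fun r q =>
      b (y - q) * (h (t + r + q) (y - q - L) - h (t + r + q) (y - q))) := by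
    unfold Function.uncurry
    refine Continuous.mul (by fun_prop) (Continuous.sub ?_ ?_) <;>
    exact cont_comp hc (by fun_prop) (by fun_prop)
  have e1' : ∫ r in (0:ℝ)..ε, h (t + s + r) (y - s) = ∫ r in (0:ℝ)..ε, (h (t + r) y
    + ∫ q in (0:ℝ)..s, b (y - q) * (h (t + r + q) (y - q - L) - h (t + r + q) (y - q))) :=
    intervalIntegral.integral_congr e1
  rw [e1', intervalIntegral.integral_add ?_ ?_, mul_add,
    swapc _ hF _ _ _ _ hs0]
  · rw [add_right_inj, ← intervalIntegral.integral_const_mul]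
    refine intervalIntegral.integral_congr (μ := volume) fun q _ => ?_
    rw [intervalIntegral.integral_const_mul, intervalIntegral.integral_sub]
    · have : ∀ r : ℝ, t + r + q = t + q + r := fun r => by ring
      simp_rw [this]; ring
    all_goals
      exact (cont_comp hc (by fun_prop) (by fun_prop)).intervalIntegrable _ _
  · exact (cont_comp hc (by fun_prop) (by fun_prop)).intervalIntegrable _ _
  · exact (intervalIntegral.continuous_parametric_intervalIntegral_of_continuous' hF 0 s).intervalIntegrable _ _

lemma avg_lip_t {ε : ℝ} (hε : 0 < ε) {h : ℝ → ℝ → ℝ} {C : ℝ} (hc : Continuous (Function.uncurry h))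
    (hb : ∀ t z, |h t z| ≤ C) (t t' z : ℝ) :
    |avg ε h t' z - avg ε h t z| ≤ 2 * C / ε * |t' - t| := by
  have hi : ∀ a b, IntervalIntegrable (fun s => h s z) volume a b := fun a b =>
    (cont_comp hc (by fun_prop) (by fun_prop)).intervalIntegrable _ _
  have e : ∀ t, avg ε h t z = (1 / ε) * ∫ s in t..(t + ε), h s z := fun t => by
    unfold avg
    rw [intervalIntegral.integral_comp_add_left (fun s => h s z)]; simp
  have e2 : (∫ s in t'..(t' + ε), h s z) - ∫ s in t..(t + ε), h s z =
      (∫ s in (t + ε)..(t' + ε), h s z) - ∫ s in t..t', h s z := by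
    rw [intervalIntegral.integral_interval_sub_interval_comm (hi _ _) (hi _ _) (hi _ _)]
    rw [intervalIntegral.integral_symm, intervalIntegral.integral_symm (t' + ε)]
    ring
  rw [e, e, ← mul_sub, e2, abs_mul, abs_of_pos (by positivity : 0 < 1 / ε)]
  have b1 := intervalIntegral.norm_integral_le_of_norm_le_const (a := t + ε) (b := t' + ε) (C := C)
    (f := fun s => h s z) (fun x _ => hb _ _)
  have b2 := intervalIntegral.norm_integral_le_of_norm_le_const (a := t) (b := t') (C := C)
    (f := fun s => h s z) (fun x _ => hb _ _)
  rw [Real.norm_eq_abs] at b1 b2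
  have b3 : t' + ε - (t + ε) = t' - t := by ring
  rw [b3] at b1
  calc 1 / ε * _ ≤ 1 / ε * (C * |t' - t| + C * |t' - t|) := by
        gcongr; exact (abs_sub _ _).trans (add_le_add b1 b2)
    _ = _ := by ring

lemma avg_avg_close {ε L : ℝ} (hε : 0 < ε) (hL : 0 < L) {h : ℝ → ℝ → ℝ} {C : ℝ}
    (hc : Continuous (Function.uncurry h)) (hC : 0 ≤ C)
    (hb : ∀ t z, |h t z| ≤ C) (t z : ℝ) :
    |avg L (avg ε h) t z - avg L h t z| ≤ 2 * C / L * ε := by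
  have e1 : avg L (avg ε h) t z = avg ε (avg L h) t z := by
    unfold avg
    rw [intervalIntegral.integral_const_mul, intervalIntegral.integral_const_mul,
      swapc (fun s r => h (t + s + r) z) (cont_comp hc (by fun_prop) (by fun_prop)) _ _ _ _ hε.le]
    have : ∀ x y : ℝ, t + x + y = t + y + x := fun r q => by ring
    simp_rw [this]; ring
  have e2 : avg L h t z = (1 / ε) * ∫ s in (0:ℝ)..ε, avg L h t z := by
    simp; field_simp
  rw [e1, e2]
  conv_lhs => enter [1, 1]; unfold avg
  rw [← mul_sub, ← intervalIntegral.integral_sub, abs_mul, abs_of_pos (by positivity : 0 < 1 / ε)]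
  · have := intervalIntegral.norm_integral_le_of_norm_le_const (a := 0) (b := ε)
      (C := 2 * C / L * ε) (f := fun s => avg L h (t + s) z - avg L h t z) (fun s hs => by
        rw [uIoc_of_le hε.le] at hs
        refine (avg_lip_t hL hc hb _ _ _).trans ?_
        rw [add_sub_cancel_left, abs_of_pos hs.1]
        gcongr; exact hs.2)
    rw [Real.norm_eq_abs, sub_zero, abs_of_pos hε] at this
    calc 1 / ε * _ ≤ 1 / ε * (2 * C / L * ε * ε) := by gcongr; exact this
      _ = _ := by field_simp
  · exact (cont_comp (avg_cont hc) (by fun_prop) (by fun_prop)).intervalIntegrable _ _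
  · simp

lemma Sol.lip_z {b : ℝ → ℝ} {L : ℝ} {h : ℝ → ℝ → ℝ} {C Λ K : ℝ} (hs : Sol b L h C)
    (hΛ : ∀ t t' z, |h t' z - h t z| ≤ Λ * |t' - t|)
    {t z z' : ℝ} (ht : 0 ≤ t) (hz : z ≤ z') (hK : ∀ x ∈ Icc z z', |b x| ≤ K) :
    |h t z' - h t z| ≤ (Λ + 2 * C * K) * (z' - z) := by
  have h1 := hs.eq t ht (z' - z) (by linarith) z'
  have h2 := hΛ t (t + (z' - z)) z
  rw [sub_sub_cancel] at h1
  rw [add_sub_cancel_left, abs_of_nonneg (by linarith : 0 ≤ z' - z)] at h2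
  have h3 := intervalIntegral.norm_integral_le_of_norm_le_const (a := 0) (b := z' - z)
    (C := K * (2 * C)) (f := fun r => b (z' - r) *
      (h (t + r) (z' - r - L) - h (t + r) (z' - r))) (fun r hr => by
        rw [uIoc_of_le (by linarith)] at hr
        have hK' := hK (z' - r) ⟨by linarith [hr.2], by linarith [hr.1]⟩
        rw [Real.norm_eq_abs, abs_mul]
        have := (abs_nonneg _).trans hK'
        gcongr
        refine (abs_sub _ _).trans ?_
        linarith [hs.bdd (t + r) (z' - r - L), hs.bdd (t + r) (z' - r)])
  rw [Real.norm_eq_abs, sub_zero, abs_of_nonneg (by linarith : 0 ≤ z' - z)] at h3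
  rw [h1] at h2
  rw [abs_le] at *
  constructor <;> nlinarith
lemma transport_fubini {Ψ : ℝ → ℝ → ℝ} {κ : ℝ → ℝ} (hΨ : Continuous (Function.uncurry Ψ))
    (hκ : Integrable κ) (hb : ∀ t z, |Ψ t z| ≤ κ z) (T : ℝ) :
    ∫ t in (0:ℝ)..T, ∫ z, Ψ t z = ∫ y, ∫ t in (0:ℝ)..T, Ψ t (y - t) := by
  have e : ∀ t, ∫ z, Ψ t z = ∫ y, Ψ t (y - t) := fun t =>
    (integral_sub_right_eq_self (fun z => Ψ t z) t).symm
  simp_rw [e]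
  apply intervalIntegral_integral_swap (f := fun t y => Ψ t (y - t))
  have h1 : Integrable (fun _ : ℝ => (1:ℝ)) (volume.restrict (uIoc 0 T)) := by
    have : IsFiniteMeasure (volume.restrict (uIoc 0 T)) := by
      rw [uIoc]; infer_instance
    exact integrable_const _
  have h2 := (Integrable.convolution_integrand (ContinuousLinearMap.mul ℝ ℝ) h1 hκ).swap
  refine h2.mono' ?_ (Eventually.of_forall fun p => ?_)
  · exact (cont_comp hΨ (by fun_prop) (by fun_prop)).aestronglyMeasurable
  · simpa [Function.uncurry] using hb p.1 (p.2 - p.1)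

lemma Sol.hasDeriv {b : ℝ → ℝ} {L : ℝ} {h : ℝ → ℝ → ℝ} {C : ℝ} (hs : Sol b L h C)
    (hb : Continuous b) {t : ℝ} (ht : 0 < t) (y : ℝ) :
    HasDerivAt (fun t => h t (y - t)) (b (y - t) * (h t (y - t - L) - h t (y - t))) t := by
  have hG : Continuous (fun r => b (y - r) * (h r (y - r - L) - h r (y - r))) := by
    refine Continuous.mul (by fun_prop) (Continuous.sub ?_ ?_) <;>
    exact cont_comp hs.cont (by fun_prop) (by fun_prop)
  have h1 : HasDerivAt (fun s => h 0 y + ∫ r in (0:ℝ)..s, b (y - r) *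
      (h r (y - r - L) - h r (y - r))) (b (y - t) * (h t (y - t - L) - h t (y - t))) t := by
    exact (intervalIntegral.integral_hasDerivAt_right (hG.intervalIntegrable _ _)
      hG.aestronglyMeasurable.stronglyMeasurableAtFilter hG.continuousAt).const_add _
  refine h1.congr_of_eventuallyEq ?_
  filter_upwards [lt_mem_nhds ht] with s hs0
  have := hs.eq 0 le_rfl s hs0.le y
  simpa using this

lemma Sol.energy {b ρ : ℝ → ℝ} {L : ℝ} {h : ℝ → ℝ → ℝ} {C : ℝ} (hs : Sol b L h C)
    (hb : Continuous b) (hb0 : ∀ z, 0 ≤ b z) (hρ0 : ∀ z, 0 ≤ ρ z)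
    (hρ : ∀ z, HasDerivAt ρ (b (z + L) * ρ (z + L) - b z * ρ z) z)
    (hρi : Integrable ρ) (hbρ : Integrable (fun z => b z * ρ z)) {T : ℝ} (hT : 0 ≤ T) :
    (∫ z, h T z ^ 2 * ρ z) + (∫ t in (0:ℝ)..T, ∫ z, b z * ρ z * (h t (z - L) - h t z) ^ 2)
      = ∫ z, h 0 z ^ 2 * ρ z := by
  have hρc : Continuous ρ := continuous_iff_continuousAt.2 fun z => (hρ z).continuousAt
  have hc := hs.cont
  have hC : ∀ t z, h t z ^ 2 ≤ C ^ 2 := fun t z => sq_le_sq' (abs_le.1 (hs.bdd t z)).1 (abs_le.1 (hs.bdd t z)).2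
  set Ψ : ℝ → ℝ → ℝ := fun t z => h t (z - L) ^ 2 * (b z * ρ z) - h t z ^ 2 * (b (z + L) * ρ (z + L))
    - b z * ρ z * (h t (z - L) - h t z) ^ 2 with hΨ
  have hc1 : Continuous (fun p : ℝ × ℝ => h p.1 p.2) := hc
  have hc2 : Continuous (fun p : ℝ × ℝ => h p.1 (p.2 - L)) := cont_comp hc (by fun_prop) (by fun_prop)
  have hΨc : Continuous (Function.uncurry Ψ) := by
    simp only [hΨ, Function.uncurry_def]; fun_prop
  have hbρL : Integrable (fun z => b (z + L) * ρ (z + L)) := hbρ.comp_add_right L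
  have hbnd : ∀ t z, |Ψ t z| ≤ 5 * C ^ 2 * (b z * ρ z) + C ^ 2 * (b (z + L) * ρ (z + L)) := by
    intro t z
    have p1 : 0 ≤ b z * ρ z := mul_nonneg (hb0 _) (hρ0 _)
    have p2 : 0 ≤ b (z + L) * ρ (z + L) := mul_nonneg (hb0 _) (hρ0 _)
    have q1 := hC t z
    have q2 := hC t (z - L)
    have q3 : (h t (z - L) - h t z) ^ 2 ≤ 4 * C ^ 2 := by nlinarith [sq_nonneg (h t (z - L) + h t z)]
    have r1 := mul_le_mul_of_nonneg_right q2 p1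
    have r2 := mul_le_mul_of_nonneg_right q1 p2
    have r3 := mul_le_mul_of_nonneg_right q3 p1
    have s1 := mul_nonneg (sq_nonneg (h t (z - L))) p1
    have s2 := mul_nonneg (sq_nonneg (h t z)) p2
    have s3 := mul_nonneg (sq_nonneg (h t (z - L) - h t z)) p1
    have s4 := mul_nonneg (sq_nonneg C) p1
    have s5 := mul_nonneg (sq_nonneg C) p2
    simp only [hΨ]
    rw [abs_le]; constructor <;> nlinarith
  have hF := transport_fubini hΨc ((hbρ.const_mul (5 * C ^ 2)).add (hbρL.const_mul (C ^ 2))) hbnd T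
  have hftc : ∀ y, ∫ t in (0:ℝ)..T, Ψ t (y - t) = h T (y - T) ^ 2 * ρ (y - T) - h 0 y ^ 2 * ρ y := by
    intro y
    have hcu : Continuous (fun t => h t (y - t)) := cont_comp hc (by fun_prop) (by fun_prop)
    have := intervalIntegral.integral_eq_sub_of_hasDerivAt_of_le hT
      (f := fun t => h t (y - t) ^ 2 * ρ (y - t)) (f' := fun t => Ψ t (y - t))
      (by fun_prop) (fun t ht => by
        have d1 := hs.hasDeriv hb ht.1 y
        have d2 : HasDerivAt (fun t => ρ (y - t)) (-(b (y - t + L) * ρ (y - t + L) - b (y - t) * ρ (y - t))) t :=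
          HasDerivAt.comp_const_sub y t (hρ (y - t))
        refine ((d1.pow 2).mul d2).congr_deriv ?_
        simp only [hΨ, Pi.pow_apply]
        push_cast
        ring)
      ((cont_comp hΨc (by fun_prop) (by fun_prop)).intervalIntegrable _ _)
    simpa using this
  simp_rw [hftc] at hF
  have hsqInt : ∀ t, Integrable (fun z => h t z ^ 2 * ρ z) := fun t => by
    refine (hρi.const_mul (C ^ 2)).mono' ?_ (Eventually.of_forall fun z => ?_)
    · have : Continuous (fun z => h t z) := cont_comp hc (by fun_prop) (by fun_prop)
      exact (by fun_prop : Continuous (fun z => h t z ^ 2 * ρ z)).aestronglyMeasurable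
    · rw [Real.norm_eq_abs, abs_of_nonneg (mul_nonneg (sq_nonneg _) (hρ0 _))]
      exact mul_le_mul_of_nonneg_right (hC _ _) (hρ0 _)
  rw [integral_sub ((hsqInt T).comp_sub_right T) (hsqInt 0),
    integral_sub_right_eq_self (fun y => h T y ^ 2 * ρ y) T] at hF
  have hin : ∀ t, ∫ z, Ψ t z = - ∫ z, b z * ρ z * (h t (z - L) - h t z) ^ 2 := by
    intro t
    have cz : Continuous (fun z => h t z) := cont_comp hc (by fun_prop) (by fun_prop)
    have i1 : Integrable (fun z => h t (z - L) ^ 2 * (b z * ρ z)) := by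
      refine hbρ.bdd_mul (c := C ^ 2) (by fun_prop : Continuous fun z => h t (z - L) ^ 2).aestronglyMeasurable
        (Eventually.of_forall fun z => ?_)
      rw [Real.norm_eq_abs, abs_of_nonneg (sq_nonneg _)]; exact hC _ _
    have i2 : Integrable (fun z => h t z ^ 2 * (b (z + L) * ρ (z + L))) := by
      refine hbρL.bdd_mul (c := C ^ 2) (by fun_prop : Continuous fun z => h t z ^ 2).aestronglyMeasurable
        (Eventually.of_forall fun z => ?_)
      rw [Real.norm_eq_abs, abs_of_nonneg (sq_nonneg _)]; exact hC _ _
    have i3 : Integrable (fun z => b z * ρ z * (h t (z - L) - h t z) ^ 2) := by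
      refine hbρ.mul_bdd (c := 4 * C ^ 2) (by fun_prop : Continuous fun z => (h t (z - L) - h t z) ^ 2).aestronglyMeasurable
        (Eventually.of_forall fun z => ?_)
      rw [Real.norm_eq_abs, abs_of_nonneg (sq_nonneg _)]
      nlinarith [sq_nonneg (h t (z - L) + h t z), hC t z, hC t (z - L)]
    have i4 : ∫ z, h t (z - L) ^ 2 * (b z * ρ z) = ∫ z, h t z ^ 2 * (b (z + L) * ρ (z + L)) := by
      rw [← integral_add_right_eq_self (fun z => h t (z - L) ^ 2 * (b z * ρ z)) L]
      simp
    simp only [hΨ]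
    have i5 : Integrable (fun z => h t (z - L) ^ 2 * (b z * ρ z) - h t z ^ 2 * (b (z + L) * ρ (z + L))) :=
      i1.sub i2
    rw [integral_sub i5 i3, integral_sub i1 i2, i4]; ring
  simp_rw [hin, intervalIntegral.integral_neg] at hF
  linarith

lemma Sol.mass {b ρ : ℝ → ℝ} {L : ℝ} {h : ℝ → ℝ → ℝ} {C : ℝ} (hs : Sol b L h C)
    (hb : Continuous b) (hb0 : ∀ z, 0 ≤ b z) (hρ0 : ∀ z, 0 ≤ ρ z)
    (hρ : ∀ z, HasDerivAt ρ (b (z + L) * ρ (z + L) - b z * ρ z) z)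
    (hρi : Integrable ρ) (hbρ : Integrable (fun z => b z * ρ z)) {T : ℝ} (hT : 0 ≤ T) :
    (∫ z, h T z * ρ z) = ∫ z, h 0 z * ρ z := by
  have hs1 : Sol b L (fun t z => h t z + 1) (C + 1) := by
    refine ⟨?_, fun t z => ?_, fun t ht s hs0 y => ?_⟩
    · have : Continuous (fun p : ℝ × ℝ => h p.1 p.2) := hs.cont
      simp only [Function.uncurry_def]; fun_prop
    · refine (abs_add_le _ _).trans ?_
      simpa using hs.bdd t z
    · rw [hs.eq t ht s hs0 y]
      simp only [add_sub_add_right_eq_sub]; ring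
  have e0 := hs.energy hb hb0 hρ0 hρ hρi hbρ hT
  have e1 := hs1.energy hb hb0 hρ0 hρ hρi hbρ hT
  simp only [add_sub_add_right_eq_sub] at e1
  have cz : ∀ t, Continuous (fun z => h t z) := fun t => cont_comp hs.cont (by fun_prop) (by fun_prop)
  have j1 : ∀ t, Integrable (fun z => h t z * ρ z) := fun t =>
    hρi.bdd_mul (c := C) (cz t).aestronglyMeasurable (Eventually.of_forall fun z => hs.bdd t z)
  have j2 : ∀ t, Integrable (fun z => h t z ^ 2 * ρ z) := fun t =>
    hρi.bdd_mul (c := C ^ 2) ((cz t).pow 2).aestronglyMeasurable (Eventually.of_forall fun z => by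
      rw [Real.norm_eq_abs, abs_of_nonneg (sq_nonneg _)]
      exact sq_le_sq' (abs_le.1 (hs.bdd t z)).1 (abs_le.1 (hs.bdd t z)).2)
  have ex : ∀ t, ∫ z, (h t z + 1) ^ 2 * ρ z = (∫ z, h t z ^ 2 * ρ z) + 2 * (∫ z, h t z * ρ z) + ∫ z, ρ z := by
    intro t
    have j3 : Integrable (fun a => h t a ^ 2 * ρ a + 2 * (h t a * ρ a)) :=
      (j2 t).add ((j1 t).const_mul 2)
    rw [← integral_const_mul, ← integral_add (j2 t) ((j1 t).const_mul 2),
      ← integral_add j3 hρi]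
    congr 1; ext z; ring
  rw [ex, ex] at e1
  linarith
lemma barbalat {D : ℝ → ℝ} {M N : ℝ} (h0 : ∀ t, 0 ≤ D t) (hl : ∀ t t', |D t' - D t| ≤ M * |t' - t|)
    (hM : 0 ≤ M)
    (hN : ∀ T ≥ 0, ∫ t in (0:ℝ)..T, D t ≤ N) : Tendsto D atTop (nhds 0) := by
  have hc : Continuous D := by
    refine (LipschitzWith.of_dist_le_mul (K := M.toNNReal) fun x y => ?_).continuous
    rw [Real.dist_eq, Real.dist_eq, Real.coe_toNNReal _ hM]
    exact hl y x
  have hi : ∀ a b, IntervalIntegrable D volume a b := fun a b => hc.intervalIntegrable _ _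
  have hd : ∀ a b, (∫ t in (0:ℝ)..b, D t) - ∫ t in (0:ℝ)..a, D t = ∫ t in a..b, D t := fun a b =>
    intervalIntegral.integral_interval_sub_left (hi _ _) (hi _ _)
  have hmono : Monotone (fun T => ∫ t in (0:ℝ)..T, D t) := by
    intro a b hab
    have := intervalIntegral.integral_nonneg (f := D) (μ := volume) hab (fun u _ => h0 u)
    have := hd a b
    simp only; linarith
  have hbd : BddAbove (range (fun T => ∫ t in (0:ℝ)..T, D t)) := by
    refine ⟨N, ?_⟩
    rintro _ ⟨T, rfl⟩
    exact (hmono (le_max_left T 0)).trans (hN _ (le_max_right T 0))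
  have ht := tendsto_atTop_ciSup hmono hbd
  rw [Metric.tendsto_atTop]
  intro η hη
  set δ : ℝ := η / (2 * (M + 1)) with hδ
  have hδ0 : 0 < δ := by positivity
  have ht2 := (ht.comp (tendsto_atTop_add_const_right atTop δ tendsto_id)).sub ht
  rw [sub_self, Metric.tendsto_atTop] at ht2
  obtain ⟨T, hT⟩ := ht2 (δ * (η / 2)) (by positivity)
  refine ⟨T, fun t htT => ?_⟩
  have h1 := hT t htT
  simp only [Function.comp, id] at h1
  rw [hd, Real.dist_eq, sub_zero] at h1
  have h2 : ∫ s in t..(t + δ), (D t - M * δ) ≤ ∫ s in t..(t + δ), D s := by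
    refine intervalIntegral.integral_mono_on (by linarith) (by simp) (hi _ _) fun s hs => ?_
    have := hl t s
    rw [abs_of_nonneg (by linarith [hs.1] : 0 ≤ s - t)] at this
    have h3 : M * (s - t) ≤ M * δ := by gcongr; linarith [hs.2]
    linarith [(abs_le.1 this).1]
  simp only [intervalIntegral.integral_const, smul_eq_mul, add_sub_cancel_left] at h2
  have h4 := (abs_lt.1 h1).2
  have h5 : D t - M * δ < η / 2 := by
    by_contra hcon
    push Not at hcon
    have := mul_le_mul_of_nonneg_left hcon hδ0.le
    linarith
  have h6 : M * δ ≤ η / 2 := by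
    rw [hδ, mul_div_assoc', div_le_div_iff₀ (by positivity) (by positivity)]
    nlinarith
  rw [Real.dist_eq, sub_zero, abs_of_nonneg (h0 t)]
  linarith

lemma Sol.dissip_tendsto {b ρ : ℝ → ℝ} {L : ℝ} {h : ℝ → ℝ → ℝ} {C Λ : ℝ} (hs : Sol b L h C)
    (hb : Continuous b) (hb0 : ∀ z, 0 ≤ b z) (hρ0 : ∀ z, 0 ≤ ρ z)
    (hρ : ∀ z, HasDerivAt ρ (b (z + L) * ρ (z + L) - b z * ρ z) z)
    (hρi : Integrable ρ) (hbρ : Integrable (fun z => b z * ρ z))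
    (hΛ0 : 0 ≤ Λ) (hΛ : ∀ t t' z, |h t' z - h t z| ≤ Λ * |t' - t|) :
    Tendsto (fun t => ∫ z, b z * ρ z * (h t (z - L) - h t z) ^ 2) atTop (nhds 0) := by
  have hC : 0 ≤ C := (abs_nonneg _).trans (hs.bdd 0 0)
  have cz : ∀ t, Continuous (fun z => h t z) := fun t => cont_comp hs.cont (by fun_prop) (by fun_prop)
  have hβ : ∀ z, 0 ≤ b z * ρ z := fun z => mul_nonneg (hb0 z) (hρ0 z)
  have i3 : ∀ t, Integrable (fun z => b z * ρ z * (h t (z - L) - h t z) ^ 2) := by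
    intro t
    have := cz t
    refine hbρ.mul_bdd (c := (2 * C) ^ 2) (by fun_prop : Continuous fun z => (h t (z - L) - h t z) ^ 2).aestronglyMeasurable
      (Eventually.of_forall fun z => ?_)
    rw [Real.norm_eq_abs, abs_of_nonneg (sq_nonneg _)]
    have h1 := abs_le.1 (hs.bdd t z)
    have h2 := abs_le.1 (hs.bdd t (z - L))
    exact sq_le_sq' (by linarith) (by linarith)
  refine barbalat (M := (2 * Λ) * (4 * C) * ∫ z, b z * ρ z) (N := ∫ z, h 0 z ^ 2 * ρ z)
    (fun t => integral_nonneg fun z => mul_nonneg (hβ z) (sq_nonneg _)) ?_ ?_ ?_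
  · intro t t'
    rw [← integral_sub (i3 _) (i3 _)]
    have : ‖∫ z, (b z * ρ z * (h t' (z - L) - h t' z) ^ 2 - b z * ρ z * (h t (z - L) - h t z) ^ 2)‖
        ≤ ∫ z, (2 * Λ) * (4 * C) * |t' - t| * (b z * ρ z) := by
      refine norm_integral_le_of_norm_le (hbρ.const_mul _) (Eventually.of_forall fun z => ?_)
      rw [← mul_sub, Real.norm_eq_abs, abs_mul, abs_of_nonneg (hβ z), mul_comm]
      refine mul_le_mul_of_nonneg_right ?_ (hβ z)
      rw [sq_sub_sq, abs_mul, mul_comm]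
      have a1 : |h t' (z - L) - h t' z - (h t (z - L) - h t z)| ≤ 2 * Λ * |t' - t| := by
        have := hΛ t t' z
        have := hΛ t t' (z - L)
        rw [abs_le] at *
        constructor <;> linarith
      have a2 : |h t' (z - L) - h t' z + (h t (z - L) - h t z)| ≤ 4 * C := by
        have h1 := abs_le.1 (hs.bdd t z)
        have h2 := abs_le.1 (hs.bdd t (z - L))
        have h3 := abs_le.1 (hs.bdd t' z)
        have h4 := abs_le.1 (hs.bdd t' (z - L))
        rw [abs_le]
        constructor <;> linarith
      calc _ ≤ (2 * Λ * |t' - t|) * (4 * C) := by gcongr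
        _ = _ := by ring
    rw [Real.norm_eq_abs, integral_const_mul] at this
    refine this.trans (le_of_eq (by ring))
  · have := integral_nonneg (μ := volume) (f := fun z => b z * ρ z) hβ
    positivity
  · intro T hT
    have := hs.energy hb hb0 hρ0 hρ hρi hbρ hT
    have h2 : 0 ≤ ∫ z, h T z ^ 2 * ρ z := integral_nonneg fun z => mul_nonneg (sq_nonneg _) (hρ0 z)
    linarith

set_option maxHeartbeats 1000000 in
lemma Sol.delta_tendsto {b ρ : ℝ → ℝ} {L : ℝ} {h : ℝ → ℝ → ℝ} {C Λ : ℝ} (hs : Sol b L h C)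
    (hb : Continuous b) (hb0 : ∀ z, 0 ≤ b z) (hρ0 : ∀ z, 0 ≤ ρ z)
    (hρ : ∀ z, HasDerivAt ρ (b (z + L) * ρ (z + L) - b z * ρ z) z)
    (hρi : Integrable ρ) (hbρ : Integrable (fun z => b z * ρ z)) (hL : 0 < L)
    (hΛ0 : 0 ≤ Λ) (hΛ : ∀ t t' z, |h t' z - h t z| ≤ Λ * |t' - t|) {z0 : ℝ}
    (hz0 : z0 ∈ closure {z | 0 < b z * ρ z}) :
    Tendsto (fun t => h t (z0 - L) - h t z0) atTop (nhds 0) := by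
  have hC : 0 ≤ C := (abs_nonneg _).trans (hs.bdd 0 0)
  have hD := hs.dissip_tendsto hb hb0 hρ0 hρ hρi hbρ hΛ0 hΛ
  have hρc : Continuous ρ := continuous_iff_continuousAt.2 fun z => (hρ z).continuousAt
  have cz : ∀ t, Continuous (fun z => h t z) := fun t => cont_comp hs.cont (by fun_prop) (by fun_prop)
  have hβ : ∀ z, 0 ≤ b z * ρ z := fun z => mul_nonneg (hb0 z) (hρ0 z)
  have i3 : ∀ t, Integrable (fun z => b z * ρ z * (h t (z - L) - h t z) ^ 2) := by
    intro t
    have := cz t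
    refine hbρ.mul_bdd (c := (2 * C) ^ 2) (by fun_prop : Continuous fun z => (h t (z - L) - h t z) ^ 2).aestronglyMeasurable
      (Eventually.of_forall fun z => ?_)
    rw [Real.norm_eq_abs, abs_of_nonneg (sq_nonneg _)]
    have h1 := abs_le.1 (hs.bdd t z)
    have h2 := abs_le.1 (hs.bdd t (z - L))
    exact sq_le_sq' (by linarith) (by linarith)
  obtain ⟨K, hK⟩ := (isCompact_Icc (a := z0 - L - 1) (b := z0 + 1)).exists_bound_of_continuousOn hb.continuousOn
  have hK0 : 0 ≤ K := (norm_nonneg _).trans (hK z0 ⟨by linarith, by linarith⟩)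
  set P := Λ + 2 * C * K with hP
  have hP0 : 0 ≤ P := by positivity
  have hlip : ∀ t ≥ 0, ∀ x ∈ Icc (z0 - L - 1) (z0 + 1), ∀ y ∈ Icc (z0 - L - 1) (z0 + 1),
      |h t y - h t x| ≤ P * |y - x| := by
    intro t ht x hx y hy
    rcases le_total x y with hxy | hxy
    · rw [abs_of_nonneg (by linarith : 0 ≤ y - x)]
      exact hs.lip_z hΛ ht hxy fun w hw => hK w ⟨by linarith [hw.1, hx.1], by linarith [hw.2, hy.2]⟩
    · rw [abs_sub_comm, abs_sub_comm y, abs_of_nonneg (by linarith : 0 ≤ x - y)]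
      exact hs.lip_z hΛ ht hxy fun w hw => hK w ⟨by linarith [hw.1, hy.1], by linarith [hw.2, hx.2]⟩
  have key : Tendsto (fun t => (h t (z0 - L) - h t z0) ^ 2) atTop (nhds 0) := by
    rw [Metric.tendsto_atTop]
    intro η hη
    obtain ⟨δ, hδ0, hδ1, hδ⟩ : ∃ δ > 0, δ ≤ 1 ∧ 8 * P ^ 2 * δ ≤ η / 2 := by
      refine ⟨min 1 (η / (16 * (P ^ 2 + 1))), by positivity, min_le_left _ _, ?_⟩
      calc 8 * P ^ 2 * min 1 (η / (16 * (P ^ 2 + 1))) ≤ 8 * P ^ 2 * (η / (16 * (P ^ 2 + 1))) := by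
            gcongr; exact min_le_right _ _
        _ ≤ η / 2 := by
            rw [mul_div_assoc', div_le_div_iff₀ (by positivity) (by positivity)]; nlinarith
    obtain ⟨z1, hz1, hz1d⟩ := Metric.mem_closure_iff.1 hz0 (δ / 2) (by positivity)
    have hz1 : 0 < b z1 * ρ z1 := hz1
    set c := b z1 * ρ z1 / 2 with hcdef
    have hc0 : 0 < c := by positivity
    have hev : ∀ᶠ z in nhds z1, c < b z * ρ z :=
      (hb.mul hρc).continuousAt.eventually (lt_mem_nhds (by simp only [Pi.mul_apply]; linarith))
    obtain ⟨δ', hδ'0, hδ'⟩ := Metric.eventually_nhds_iff.1 hev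
    set d := min (δ' / 2) (δ / 2) with hd
    have hd0 : 0 < d := by positivity
    rw [Metric.tendsto_atTop] at hD
    obtain ⟨T, hT⟩ := hD (d * c * (η / 2)) (by positivity)
    refine ⟨max T 0, fun t ht => ?_⟩
    have hT1 := hT t (le_of_max_le_left ht)
    have ht0 : 0 ≤ t := le_of_max_le_right ht
    rw [Real.dist_eq, sub_zero] at hT1
    have hT2 := (abs_lt.1 hT1).2
    set m0 := (h t (z0 - L) - h t z0) ^ 2 / 2 - 4 * P ^ 2 * δ with hm0
    have h1 : ∫ z in Icc (z1 - d) (z1 + d), c * m0 ≤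
        ∫ z in Icc (z1 - d) (z1 + d), b z * ρ z * (h t (z - L) - h t z) ^ 2 := by
      refine setIntegral_mono_on (integrableOn_const (by simp)) (i3 t).integrableOn measurableSet_Icc fun z hz => ?_
      have g1 : c < b z * ρ z := hδ' (by
        rw [Real.dist_eq, abs_lt]
        have := min_le_left (δ' / 2) (δ / 2)
        constructor <;> linarith [hz.1, hz.2])
      have g2 : |z - z0| ≤ δ := by
        rw [Real.dist_eq, abs_lt] at hz1d
        have := min_le_right (δ' / 2) (δ / 2)
        rw [abs_le]
        constructor <;> linarith [hz.1, hz.2]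
      have g2' := abs_le.1 g2
      have g3 := hlip t ht0 z0 ⟨by linarith, by linarith⟩ z ⟨by linarith, by linarith⟩
      have g4 := hlip t ht0 (z0 - L) ⟨by linarith, by linarith⟩ (z - L) ⟨by linarith, by linarith⟩
      rw [sub_sub_sub_cancel_right] at g4
      have g5 : P * |z - z0| ≤ P * δ := by gcongr
      have g6 : |(h t (z - L) - h t z) - (h t (z0 - L) - h t z0)| ≤ 2 * P * δ := by
        rw [abs_le] at *
        constructor <;> linarith
      have g7 : ((h t (z - L) - h t z) - (h t (z0 - L) - h t z0)) ^ 2 ≤ (2 * P * δ) ^ 2 :=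
        sq_le_sq' (abs_le.1 g6).1 (abs_le.1 g6).2
      have g8 : (2 * P * δ) ^ 2 ≤ 4 * P ^ 2 * δ := by
        have : P ^ 2 * (δ * δ) ≤ P ^ 2 * (δ * 1) := by gcongr
        nlinarith
      have g9 : m0 ≤ (h t (z - L) - h t z) ^ 2 := by
        rw [hm0]
        nlinarith [sq_nonneg ((h t (z - L) - h t z) + ((h t (z - L) - h t z) - (h t (z0 - L) - h t z0)))]
      calc c * m0 ≤ c * (h t (z - L) - h t z) ^ 2 := by gcongr
        _ ≤ _ := by gcongr
    have h2 := setIntegral_le_integral (s := Icc (z1 - d) (z1 + d)) (i3 t)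
      (Eventually.of_forall fun z => mul_nonneg (hβ z) (sq_nonneg _))
    simp only [integral_const, smul_eq_mul] at h1
    rw [measureReal_restrict_apply_univ, Real.volume_real_Icc_of_le (by linarith)] at h1
    rw [Real.dist_eq, sub_zero, abs_of_nonneg (sq_nonneg _)]
    have h3 : d * c * (2 * m0) < d * c * (η / 2) := by
      have : (z1 + d - (z1 - d)) * (c * m0) = d * c * (2 * m0) := by ring
      rw [this] at h1
      exact (h1.trans h2).trans_lt hT2
    have h4 := lt_of_mul_lt_mul_left h3 (by positivity)
    rw [hm0] at h4
    linarith
  have := key.sqrt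
  simp only [Real.sqrt_zero, Real.sqrt_sq_eq_abs] at this
  exact (tendsto_zero_iff_abs_tendsto_zero _).2 this
lemma mass_avg {b ρ : ℝ → ℝ} {L : ℝ} {h : ℝ → ℝ → ℝ} {C ε : ℝ} (hs : Sol b L h C)
    (hb : Continuous b) (hb0 : ∀ z, 0 ≤ b z) (hρ0 : ∀ z, 0 ≤ ρ z)
    (hρ : ∀ z, HasDerivAt ρ (b (z + L) * ρ (z + L) - b z * ρ z) z)
    (hρi : Integrable ρ) (hbρ : Integrable (fun z => b z * ρ z)) (hε : 0 < ε) :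
    (∫ z, avg ε h 0 z * ρ z) = ∫ z, h 0 z * ρ z := by
  have hρc : Continuous ρ := continuous_iff_continuousAt.2 fun z => (hρ z).continuousAt
  have e1 : ∀ z, avg ε h 0 z * ρ z = (1 / ε) * ∫ s in (0:ℝ)..ε, h s z * ρ z := by
    intro z
    unfold avg
    rw [intervalIntegral.integral_mul_const]
    simp only [zero_add]; ring
  simp_rw [e1]
  rw [integral_const_mul, ← intervalIntegral_integral_swap (f := fun s z => h s z * ρ z)]
  · have : ∫ s in (0:ℝ)..ε, ∫ z, h s z * ρ z = ∫ s in (0:ℝ)..ε, ∫ z, h 0 z * ρ z := by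
      refine intervalIntegral.integral_congr (μ := volume) fun s hs' => ?_
      rw [uIcc_of_le hε.le] at hs'
      exact hs.mass hb hb0 hρ0 hρ hρi hbρ hs'.1
    rw [this, intervalIntegral.integral_const, smul_eq_mul, sub_zero, ← mul_assoc,
      one_div_mul_cancel hε.ne', one_mul]
  · have : IsFiniteMeasure (volume.restrict (uIoc 0 ε)) := by
      rw [uIoc]; infer_instance
    have h1 : Integrable (fun p : ℝ × ℝ => ρ p.2) ((volume.restrict (uIoc 0 ε)).prod volume) :=
      hρi.comp_snd _
    have hc1 : Continuous (fun p : ℝ × ℝ => h p.1 p.2) := hs.cont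
    exact h1.bdd_mul (c := C) hc1.aestronglyMeasurable (Eventually.of_forall fun p => hs.bdd _ _)

lemma Sol.avg_sub_tendsto {b ρ : ℝ → ℝ} {L : ℝ} {h : ℝ → ℝ → ℝ} {C Λ : ℝ} (hs : Sol b L h C)
    (hb : Continuous b) (hb0 : ∀ z, 0 ≤ b z) (hρ0 : ∀ z, 0 ≤ ρ z)
    (hρ : ∀ z, HasDerivAt ρ (b (z + L) * ρ (z + L) - b z * ρ z) z)
    (hρi : Integrable ρ) (hbρ : Integrable (fun z => b z * ρ z)) (hL : 0 < L)
    (hΛ0 : 0 ≤ Λ) (hΛ : ∀ t t' z, |h t' z - h t z| ≤ Λ * |t' - t|)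
    (H1 : ∀ z, b z ≠ 0 → z ∈ closure {z | 0 < b z * ρ z}) (z : ℝ) :
    Tendsto (fun t => _root_.avg L h t z - (1 / L) * ∫ s in (0:ℝ)..L, h t (z + s)) atTop (nhds 0) := by
  have hc := hs.cont
  have hbd : ∀ t z t' z', |h t z - h t' z'| ≤ 2 * C := fun t z t' z' =>
    (abs_sub _ _).trans (by linarith [hs.bdd t z, hs.bdd t' z'])
  have hpt : ∀ z, Tendsto (fun t => b z * (h t (z - L) - h t z)) atTop (nhds 0) := by
    intro z
    by_cases h0 : b z = 0
    · simp [h0]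
    · simpa using (hs.delta_tendsto hb hb0 hρ0 hρ hρi hbρ hL hΛ0 hΛ (H1 z h0)).const_mul (b z)
  have e1 : ∀ s ∈ uIoc 0 L, Tendsto (fun t => h (t + s) z - h t (z + s)) atTop (nhds 0) := by
    intro s hs'
    rw [uIoc_of_le hL.le] at hs'
    have h1 : Tendsto (fun t => ∫ r in (0:ℝ)..s, b (z + s - r) * (h (t + r) (z + s - r - L) -
        h (t + r) (z + s - r))) atTop (nhds (∫ r in (0:ℝ)..s, (0:ℝ))) := by
      refine intervalIntegral.tendsto_integral_filter_of_dominated_convergence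
        (fun r => |b (z + s - r)| * (2 * C)) ?_ ?_ ?_ ?_
      · refine Eventually.of_forall fun t => Continuous.aestronglyMeasurable ?_
        refine Continuous.mul (by fun_prop) (Continuous.sub ?_ ?_) <;>
        exact cont_comp hc (by fun_prop) (by fun_prop)
      · refine Eventually.of_forall fun t => Eventually.of_forall fun r _ => ?_
        rw [Real.norm_eq_abs, abs_mul]
        gcongr
        exact hbd _ _ _ _
      · exact (by fun_prop : Continuous fun r => |b (z + s - r)| * (2 * C)).intervalIntegrable _ _
      · refine Eventually.of_forall fun r _ => ?_
        exact (hpt (z + s - r)).comp (tendsto_atTop_add_const_right atTop r tendsto_id)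
    rw [intervalIntegral.integral_zero] at h1
    refine h1.congr' ?_
    filter_upwards [eventually_ge_atTop 0] with t ht
    have := hs.eq t ht s hs'.1.le (z + s)
    rw [add_sub_cancel_right] at this
    rw [this]; ring
  have e2 : Tendsto (fun t => ∫ s in (0:ℝ)..L, (h (t + s) z - h t (z + s))) atTop
      (nhds (∫ s in (0:ℝ)..L, (0:ℝ))) := by
    refine intervalIntegral.tendsto_integral_filter_of_dominated_convergence
      (fun r => 2 * C) ?_ ?_ ?_ ?_
    · refine Eventually.of_forall fun t => Continuous.aestronglyMeasurable ?_
      refine Continuous.sub ?_ ?_ <;>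
      exact cont_comp hc (by fun_prop) (by fun_prop)
    · exact Eventually.of_forall fun t => Eventually.of_forall fun r _ => hbd _ _ _ _
    · simp
    · exact Eventually.of_forall e1
  have e3 := e2.const_mul (1 / L)
  rw [intervalIntegral.integral_zero, mul_zero] at e3
  refine e3.congr fun t => ?_
  rw [intervalIntegral.integral_sub, mul_sub]
  · rfl
  all_goals exact (cont_comp hc (by fun_prop) (by fun_prop)).intervalIntegrable _ _

lemma Sol.I_sub_tendsto {b ρ : ℝ → ℝ} {L : ℝ} {h : ℝ → ℝ → ℝ} {C Λ : ℝ} (hs : Sol b L h C)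
    (hb : Continuous b) (hb0 : ∀ z, 0 ≤ b z) (hρ0 : ∀ z, 0 ≤ ρ z)
    (hρ : ∀ z, HasDerivAt ρ (b (z + L) * ρ (z + L) - b z * ρ z) z)
    (hρi : Integrable ρ) (hbρ : Integrable (fun z => b z * ρ z)) (hL : 0 < L)
    (hΛ0 : 0 ≤ Λ) (hΛ : ∀ t t' z, |h t' z - h t z| ≤ Λ * |t' - t|) {z1 z2 : ℝ}
    (H1 : ∀ z ∈ uIcc z1 z2, z + L ∈ closure {z | 0 < b z * ρ z}) :
    Tendsto (fun t => (∫ s in (0:ℝ)..L, h t (z1 + s)) - ∫ s in (0:ℝ)..L, h t (z2 + s)) atTop (nhds 0) := by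
  have hc := hs.cont
  have hbd : ∀ t z t' z', |h t z - h t' z'| ≤ 2 * C := fun t z t' z' =>
    (abs_sub _ _).trans (by linarith [hs.bdd t z, hs.bdd t' z'])
  have h1 : Tendsto (fun t => ∫ x in z1..z2, (h t x - h t (x + L))) atTop
      (nhds (∫ x in z1..z2, (0:ℝ))) := by
    refine intervalIntegral.tendsto_integral_filter_of_dominated_convergence
      (fun r => 2 * C) ?_ ?_ ?_ ?_
    · refine Eventually.of_forall fun t => Continuous.aestronglyMeasurable ?_
      refine Continuous.sub ?_ ?_ <;>
      exact cont_comp hc (by fun_prop) (by fun_prop)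
    · exact Eventually.of_forall fun t => Eventually.of_forall fun r _ => hbd _ _ _ _
    · simp
    · refine Eventually.of_forall fun x hx => ?_
      have := hs.delta_tendsto hb hb0 hρ0 hρ hρi hbρ hL hΛ0 hΛ (H1 x (uIoc_subset_uIcc hx))
      simpa using this
  rw [intervalIntegral.integral_zero] at h1
  refine h1.congr fun t => ?_
  have hi : ∀ a b, IntervalIntegrable (fun x => h t x) volume a b := fun a b =>
    (cont_comp hc (by fun_prop) (by fun_prop)).intervalIntegrable _ _
  rw [intervalIntegral.integral_sub (hi _ _)
    ((cont_comp hc (by fun_prop) (by fun_prop)).intervalIntegrable _ _),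
    intervalIntegral.integral_comp_add_right (fun x => h t x),
    intervalIntegral.integral_comp_add_left (fun x => h t x),
    intervalIntegral.integral_comp_add_left (fun x => h t x), add_zero, add_zero,
    intervalIntegral.integral_interval_sub_interval_comm (hi _ _) (hi _ _) (hi _ _)]

lemma Sol.avg_tendsto {b ρ : ℝ → ℝ} {L : ℝ} {h : ℝ → ℝ → ℝ} {C Λ : ℝ} (hs : Sol b L h C)
    (hb : Continuous b) (hb0 : ∀ z, 0 ≤ b z) (hρ0 : ∀ z, 0 ≤ ρ z)
    (hρ : ∀ z, HasDerivAt ρ (b (z + L) * ρ (z + L) - b z * ρ z) z)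
    (hρi : Integrable ρ) (hbρ : Integrable (fun z => b z * ρ z)) (hL : 0 < L)
    (hρ1 : ∫ z, ρ z = 1)
    (hΛ0 : 0 ≤ Λ) (hΛ : ∀ t t' z, |h t' z - h t z| ≤ Λ * |t' - t|)
    (H1 : ∀ z, b z ≠ 0 → z ∈ closure {z | 0 < b z * ρ z})
    (H2 : ∀ z, ρ z ≠ 0 → ∀ x ≥ z, x + L ∈ closure {z | 0 < b z * ρ z}) {z : ℝ}
    (hz : ∀ x ≥ z, x + L ∈ closure {z | 0 < b z * ρ z}) :
    Tendsto (fun t => _root_.avg L h t z) atTop (nhds (∫ z, h 0 z * ρ z)) := by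
  have hsa := hs.avg hb hL
  have hdiff : ∀ z', (∀ x ≥ z', x + L ∈ closure {z | 0 < b z * ρ z}) →
      Tendsto (fun t => _root_.avg L h t z - _root_.avg L h t z') atTop (nhds 0) := by
    intro z' hz'
    have a1 := hs.avg_sub_tendsto hb hb0 hρ0 hρ hρi hbρ hL hΛ0 hΛ H1 z
    have a2 := hs.avg_sub_tendsto hb hb0 hρ0 hρ hρi hbρ hL hΛ0 hΛ H1 z'
    have a3 := (hs.I_sub_tendsto hb hb0 hρ0 hρ hρi hbρ hL hΛ0 hΛ (z1 := z) (z2 := z') (by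
      intro x hx
      rw [mem_uIcc] at hx
      rcases hx with hx | hx
      · exact hz x hx.1
      · exact hz' x hx.1)).const_mul (1 / L)
    have := (a1.sub a2).add a3
    simp only [sub_zero, mul_zero, add_zero] at this
    refine this.congr fun t => ?_
    ring
  have h1 : Tendsto (fun t => ∫ x, (_root_.avg L h t z - _root_.avg L h t x) * ρ x) atTop
      (nhds (∫ x : ℝ, (0:ℝ))) := by
    refine MeasureTheory.tendsto_integral_filter_of_dominated_convergence
      (fun x => 2 * C * ρ x) ?_ ?_ ?_ ?_
    · refine Eventually.of_forall fun t => AEStronglyMeasurable.mul ?_ hρi.aestronglyMeasurable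
      exact (continuous_const.sub (cont_comp hsa.cont (by fun_prop) (by fun_prop))).aestronglyMeasurable
    · refine Eventually.of_forall fun t => Eventually.of_forall fun x => ?_
      rw [norm_mul, Real.norm_eq_abs, Real.norm_eq_abs, abs_of_nonneg (hρ0 x)]
      refine mul_le_mul_of_nonneg_right ?_ (hρ0 x)
      exact (abs_sub _ _).trans (by linarith [hsa.bdd t z, hsa.bdd t x])
    · exact hρi.const_mul _
    · refine Eventually.of_forall fun x => ?_
      by_cases h0 : ρ x = 0
      · simp [h0]
      · simpa using (hdiff x (H2 x h0)).mul_const (ρ x)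
  rw [integral_zero] at h1
  have h2 := h1.add_const (∫ z, h 0 z * ρ z)
  rw [zero_add] at h2
  refine h2.congr' ?_
  filter_upwards [eventually_ge_atTop 0] with t ht
  have m1 := hsa.mass hb hb0 hρ0 hρ hρi hbρ ht
  rw [mass_avg hs hb hb0 hρ0 hρ hρi hbρ hL] at m1
  simp_rw [sub_mul]
  rw [integral_sub (hρi.const_mul _), m1, integral_const_mul, hρ1]
  · ring
  · exact hρi.bdd_mul (c := C) (cont_comp hsa.cont (by fun_prop) (by fun_prop)).aestronglyMeasurable
      (Eventually.of_forall fun x => hsa.bdd _ _)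

lemma Sol.avg_tendsto' {b ρ : ℝ → ℝ} {L : ℝ} {h : ℝ → ℝ → ℝ} {C : ℝ} (hs : Sol b L h C)
    (hb : Continuous b) (hb0 : ∀ z, 0 ≤ b z) (hρ0 : ∀ z, 0 ≤ ρ z)
    (hρ : ∀ z, HasDerivAt ρ (b (z + L) * ρ (z + L) - b z * ρ z) z)
    (hρi : Integrable ρ) (hbρ : Integrable (fun z => b z * ρ z)) (hL : 0 < L)
    (hρ1 : ∫ z, ρ z = 1)
    (H1 : ∀ z, b z ≠ 0 → z ∈ closure {z | 0 < b z * ρ z})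
    (H2 : ∀ z, ρ z ≠ 0 → ∀ x ≥ z, x + L ∈ closure {z | 0 < b z * ρ z}) {z : ℝ}
    (hz : ∀ x ≥ z, x + L ∈ closure {z | 0 < b z * ρ z}) :
    Tendsto (fun t => _root_.avg L h t z) atTop (nhds (∫ z, h 0 z * ρ z)) := by
  have hC : 0 ≤ C := (abs_nonneg _).trans (hs.bdd 0 0)
  rw [Metric.tendsto_atTop]
  intro η hη
  set ε := η * L / (4 * (C + 1)) with hε
  have hε0 : 0 < ε := by positivity
  have h1 := (hs.avg hb hε0).avg_tendsto hb hb0 hρ0 hρ hρi hbρ hL hρ1 (Λ := 2 * C / ε) (by positivity)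
    (fun t t' z => avg_lip_t hε0 hs.cont hs.bdd t t' z) H1 H2 hz
  rw [mass_avg hs hb hb0 hρ0 hρ hρi hbρ hε0, Metric.tendsto_atTop] at h1
  obtain ⟨T, hT⟩ := h1 (η / 2) (by positivity)
  refine ⟨T, fun t ht => ?_⟩
  have h2 := avg_avg_close hε0 hL hs.cont hC hs.bdd t z
  have h3 := hT t ht
  rw [Real.dist_eq] at *
  have h4 : 2 * C / L * ε ≤ η / 2 := by
    rw [hε]
    have : 2 * C / L * (η * L / (4 * (C + 1))) = (η / 2) * (C / (C + 1)) := by field_simp; ring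
    rw [this]
    have : C / (C + 1) ≤ 1 := by rw [div_le_one (by positivity)]; linarith
    nlinarith
  rw [abs_lt] at *
  rw [abs_le] at h2
  constructor <;> linarith

theorem Sol.core {b ρ : ℝ → ℝ} {L : ℝ} {h : ℝ → ℝ → ℝ} {C : ℝ} (hs : Sol b L h C)
    (hb : Continuous b) (hb0 : ∀ z, 0 ≤ b z) (hρ0 : ∀ z, 0 ≤ ρ z)
    (hρ : ∀ z, HasDerivAt ρ (b (z + L) * ρ (z + L) - b z * ρ z) z)
    (hρi : Integrable ρ) (hbρ : Integrable (fun z => b z * ρ z)) (hL : 0 < L)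
    (hρ1 : ∫ z, ρ z = 1)
    (H1 : ∀ z, b z ≠ 0 → z ∈ closure {z | 0 < b z * ρ z})
    (H2 : ∀ z, ρ z ≠ 0 → ∀ x ≥ z, x + L ∈ closure {z | 0 < b z * ρ z})
    (H3 : ∀ z, ∃ z' ≥ z, (∀ x ∈ Icc z z', z < z' → b x = 0) ∧
      ∀ x ≥ z', x + L ∈ closure {z | 0 < b z * ρ z})
    {K : Set ℝ} (hK : IsCompact K) {η : ℝ} (hη : 0 < η) :
    ∃ T, ∀ t ≥ T, ∀ z ∈ K, |_root_.avg L h t z - ∫ z, h 0 z * ρ z| ≤ η := by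
  have hC : 0 ≤ C := (abs_nonneg _).trans (hs.bdd 0 0)
  have hsa := hs.avg hb hL
  have hpt : ∀ z, Tendsto (fun t => _root_.avg L h t z) atTop (nhds (∫ z, h 0 z * ρ z)) := by
    intro z
    obtain ⟨z', hz', hb', hc'⟩ := H3 z
    have h1 := hs.avg_tendsto' hb hb0 hρ0 hρ hρi hbρ hL hρ1 H1 H2 hc'
    rcases hz'.eq_or_lt with he | hlt
    · rwa [he]
    have h2 := h1.comp (tendsto_atTop_add_const_right atTop (-(z' - z)) tendsto_id)
    refine h2.congr' ?_
    filter_upwards [eventually_ge_atTop (z' - z)] with t ht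
    have := hsa.eq (t - (z' - z)) (by linarith) (z' - z) (by linarith) z'
    have e : ∫ r in (0:ℝ)..(z' - z), b (z' - r) * (_root_.avg L h (t - (z' - z) + r) (z' - r - L) -
        _root_.avg L h (t - (z' - z) + r) (z' - r)) = ∫ r in (0:ℝ)..(z' - z), (0:ℝ) := by
      refine intervalIntegral.integral_congr (μ := volume) fun r hr => ?_
      rw [uIcc_of_le (by linarith)] at hr
      rw [hb' (z' - r) ⟨by linarith [hr.2], by linarith [hr.1]⟩ hlt, zero_mul]
    rw [e, intervalIntegral.integral_zero, sub_add_cancel, sub_sub_cancel, add_zero] at this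
    rw [this]
    simp [sub_eq_add_neg]
  refine hK.induction_on (p := fun s => ∃ T, ∀ t ≥ T, ∀ z ∈ s,
    |_root_.avg L h t z - ∫ z, h 0 z * ρ z| ≤ η) ⟨0, by simp⟩ ?_ ?_ ?_
  · rintro s s' hss ⟨T, hT⟩
    exact ⟨T, fun t ht z hz => hT t ht z (hss hz)⟩
  · rintro s s' ⟨T, hT⟩ ⟨T', hT'⟩
    refine ⟨max T T', fun t ht z hz => ?_⟩
    rcases hz with hz | hz
    · exact hT t (le_of_max_le_left ht) z hz
    · exact hT' t (le_of_max_le_right ht) z hz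
  · intro z0 _
    obtain ⟨M, hM⟩ := (isCompact_Icc (a := z0 - 1) (b := z0 + 1)).exists_bound_of_continuousOn hb.continuousOn
    have hM0 : 0 ≤ M := (norm_nonneg _).trans (hM z0 ⟨by linarith, by linarith⟩)
    set P := 2 * C / L + 2 * C * M with hP
    have hP0 : 0 ≤ P := by positivity
    have hlip : ∀ t ≥ 0, ∀ x ∈ Icc (z0 - 1) (z0 + 1), ∀ y ∈ Icc (z0 - 1) (z0 + 1),
        |_root_.avg L h t y - _root_.avg L h t x| ≤ P * |y - x| := by
      intro t ht x hx y hy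
      have hΛ := fun t t' z => avg_lip_t hL hs.cont hs.bdd t t' z
      rcases le_total x y with hxy | hxy
      · rw [abs_of_nonneg (by linarith : 0 ≤ y - x)]
        exact hsa.lip_z hΛ ht hxy fun w hw => hM w ⟨by linarith [hw.1, hx.1], by linarith [hw.2, hy.2]⟩
      · rw [abs_sub_comm, abs_sub_comm y, abs_of_nonneg (by linarith : 0 ≤ x - y)]
        exact hsa.lip_z hΛ ht hxy fun w hw => hM w ⟨by linarith [hw.1, hy.1], by linarith [hw.2, hx.2]⟩
    have h1 := hpt z0
    rw [Metric.tendsto_atTop] at h1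
    obtain ⟨T, hT⟩ := h1 (η / 2) (by positivity)
    set δ := min 1 (η / (2 * (P + 1))) with hδ
    have hδ0 : 0 < δ := by positivity
    refine ⟨Metric.ball z0 δ, mem_nhdsWithin_of_mem_nhds (Metric.ball_mem_nhds _ hδ0),
      max T 0, fun t ht z hz => ?_⟩
    rw [Metric.mem_ball, Real.dist_eq] at hz
    have d1 : δ ≤ 1 := min_le_left _ _
    have d2 : P * δ ≤ η / 2 := by
      calc P * δ ≤ P * (η / (2 * (P + 1))) := by gcongr; exact min_le_right _ _
        _ ≤ η / 2 := by
          rw [mul_div_assoc', div_le_div_iff₀ (by positivity) (by positivity)]; nlinarith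
    have hz' := abs_lt.1 hz
    have h2 := hlip t (le_of_max_le_right ht) z0 ⟨by linarith, by linarith⟩ z ⟨by linarith, by linarith⟩
    have h3 : P * |z - z0| ≤ P * δ := by gcongr
    have h4 := hT t (le_of_max_le_left ht)
    rw [Real.dist_eq] at h4
    have h5 := abs_le.1 h2
    have h6 := abs_lt.1 h4
    rw [abs_le]
    constructor <;> linarith

/-- Cesaro means. -/
lemma cesaro {h : ℝ → ℝ → ℝ} {L C m : ℝ} (hL : 0 < L) (hc : Continuous (Function.uncurry h))
    (hb : ∀ t z, |h t z| ≤ C) {K : Set ℝ}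
    (H : ∀ η > 0, ∃ T, ∀ t ≥ T, ∀ z ∈ K, |avg L h t z - m| ≤ η) {η : ℝ} (hη : 0 < η) :
    ∃ T, ∀ t ≥ T, ∀ z ∈ K, |(1 / t) * (∫ s in (0:ℝ)..t, h s z) - m| ≤ η := by
  have hC : 0 ≤ C := (abs_nonneg _).trans (hb 0 0)
  obtain ⟨T, hT⟩ := H (η / 2) (by positivity)
  set T1 := max T 1 with hT1
  have hT1p : 0 < T1 := lt_of_lt_of_le one_pos (le_max_right _ _)
  set Q := 2 * C * L + T1 * (C + |m|) with hQ
  have hQ0 : 0 ≤ Q := by positivity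
  refine ⟨max T1 (2 * Q / η), fun t ht z hz => ?_⟩
  have ht1 : T1 ≤ t := le_of_max_le_left ht
  have ht2 : 2 * Q / η ≤ t := le_of_max_le_right ht
  have ht0 : 0 < t := hT1p.trans_le ht1
  have e1 : (1 / t) * (∫ s in (0:ℝ)..t, h s z) = avg t h 0 z := by
    unfold avg; simp
  have e2 := avg_avg_close (h := h) (ε := L) (L := t) hL ht0 hc hC hb 0 z
  have ca : Continuous (fun s => avg L h s z) := cont_comp (avg_cont hc) (by fun_prop) (by fun_prop)
  have hi : ∀ a b, IntervalIntegrable (fun s => avg L h s z - m) volume a b := fun a b =>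
    (ca.sub continuous_const).intervalIntegrable _ _
  have e3 : avg t (avg L h) 0 z - m = (1 / t) * ((∫ s in (0:ℝ)..T1, (avg L h s z - m)) +
      ∫ s in T1..t, (avg L h s z - m)) := by
    rw [intervalIntegral.integral_add_adjacent_intervals (hi _ _) (hi _ _),
      intervalIntegral.integral_sub (ca.intervalIntegrable _ _) (by simp)]
    have e4 : avg t (avg L h) 0 z = (1 / t) * ∫ s in (0:ℝ)..t, avg L h s z := by
      rw [avg]; simp
    rw [e4]
    simp
    field_simp
  have b1 := intervalIntegral.norm_integral_le_of_norm_le_const (a := 0) (b := T1) (C := C + |m|)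
    (f := fun s => avg L h s z - m) (fun s _ => (abs_sub _ _).trans
      (add_le_add (avg_bdd hL hb s z) le_rfl))
  have b2 := intervalIntegral.norm_integral_le_of_norm_le_const (a := T1) (b := t) (C := η / 2)
    (f := fun s => avg L h s z - m) (fun s hs => by
      rw [uIoc_of_le ht1] at hs
      exact hT s ((le_max_left _ _).trans hs.1.le) z hz)
  rw [Real.norm_eq_abs, sub_zero, abs_of_pos hT1p] at b1
  rw [Real.norm_eq_abs, abs_of_nonneg (by linarith : 0 ≤ t - T1)] at b2
  have b3 : |avg t (avg L h) 0 z - m| ≤ (1 / t) * ((C + |m|) * T1 + η / 2 * (t - T1)) := by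
    rw [e3, abs_mul, abs_of_pos (by positivity : 0 < 1 / t)]
    gcongr
    exact (abs_add_le _ _).trans (add_le_add b1 b2)
  rw [e1]
  have b4 : |avg t h 0 z - m| ≤ 2 * C / t * L + (1 / t) * ((C + |m|) * T1 + η / 2 * (t - T1)) := by
    rw [abs_le] at *
    constructor <;> linarith
  refine b4.trans ?_
  have b5 : 2 * C / t * L + (1 / t) * ((C + |m|) * T1 + η / 2 * (t - T1)) =
      (Q + η / 2 * (t - T1)) / t := by rw [hQ]; field_simp; ring
  rw [b5, div_le_iff₀ ht0]
  rw [div_le_iff₀ hη] at ht2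
  nlinarith

/-! ### Part 5: mild solutions in logarithmic coordinates -/

def prim (b : ℝ → ℝ) (y t : ℝ) : ℝ := ∫ s in (0:ℝ)..t, b (y - s)

lemma prim_hasDeriv {b : ℝ → ℝ} (hb : Continuous b) (y t : ℝ) :
    HasDerivAt (prim b y) (b (y - t)) t := by
  have hc : Continuous (fun s => b (y - s)) := by fun_prop
  exact intervalIntegral.integral_hasDerivAt_right (hc.intervalIntegrable _ _)
    (hc.stronglyMeasurableAtFilter _ _) hc.continuousAt

lemma prim_cont {b : ℝ → ℝ} (hb : Continuous b) (y : ℝ) : Continuous (prim b y) :=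
  continuous_iff_continuousAt.2 fun t => (prim_hasDeriv hb y t).continuousAt

lemma prim_zero (b : ℝ → ℝ) (y : ℝ) : prim b y 0 = 0 := by simp [prim]

lemma prim_mono {b : ℝ → ℝ} (hb : Continuous b) (hb0 : ∀ z, 0 ≤ b z) (y : ℝ) :
    Monotone (prim b y) :=
  monotone_of_hasDerivAt_nonneg (fun t => prim_hasDeriv hb y t) (fun t => hb0 _)

lemma exp_prim_integral {b : ℝ → ℝ} (hb : Continuous b) (y t : ℝ) :
    ∫ σ in (0:ℝ)..t, b (y - σ) * exp (prim b y σ) = exp (prim b y t) - 1 := by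
  have := prim_cont hb y
  rw [intervalIntegral.integral_eq_sub_of_hasDerivAt (f := fun σ => exp (prim b y σ))]
  · simp [prim_zero]
  · intro σ _
    have := (prim_hasDeriv hb y σ).exp
    exact this.congr_deriv (by ring)
  · exact Continuous.intervalIntegrable (by fun_prop) _ _

lemma gron {b F : ℝ → ℝ} {y t G c K : ℝ} {n : ℕ} (hb : Continuous b) (hb0 : ∀ z, 0 ≤ b z)
    (hK : ∀ z ≤ y, b z ≤ K) (ht : 0 ≤ t) (hc : 0 ≤ c)
    (hF : ∀ σ, 0 ≤ σ → σ ≤ t → |F σ| ≤ G + c * σ ^ n) :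
    |exp (-prim b y t) * ∫ σ in (0:ℝ)..t, b (y - σ) * (exp (prim b y σ) * F σ)|
      ≤ G * (1 - exp (-prim b y t)) + K * c * t ^ (n + 1) / (n + 1) := by
  have hpc := prim_cont hb y
  have h1 : |∫ σ in (0:ℝ)..t, b (y - σ) * (exp (prim b y σ) * F σ)|
      ≤ ∫ σ in (0:ℝ)..t, (G * (b (y - σ) * exp (prim b y σ)) +
          K * c * exp (prim b y t) * σ ^ n) := by
    rw [← Real.norm_eq_abs]
    refine intervalIntegral.norm_integral_le_of_norm_le ht ?_ ?_
    · refine Eventually.of_forall fun σ hσ => ?_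
      have hσ0 := hσ.1.le
      rw [norm_mul, norm_mul, Real.norm_eq_abs, Real.norm_eq_abs, Real.norm_eq_abs,
        abs_of_nonneg (hb0 _), abs_of_nonneg (exp_pos _).le]
      have e1 : exp (prim b y σ) ≤ exp (prim b y t) :=
        exp_le_exp.2 (prim_mono hb hb0 y hσ.2)
      have e2 : b (y - σ) ≤ K := hK _ (by linarith)
      have e3 : 0 ≤ c * σ ^ n := by positivity
      calc b (y - σ) * (exp (prim b y σ) * |F σ|)
          ≤ b (y - σ) * (exp (prim b y σ) * (G + c * σ ^ n)) := by
            have := hF σ hσ0 hσ.2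
            have := hb0 (y - σ)
            gcongr
        _ = G * (b (y - σ) * exp (prim b y σ)) +
            b (y - σ) * exp (prim b y σ) * (c * σ ^ n) := by ring
        _ ≤ G * (b (y - σ) * exp (prim b y σ)) + K * exp (prim b y t) * (c * σ ^ n) := by
            have := hb0 (y - σ)
            have : b (y - σ) * exp (prim b y σ) ≤ K * exp (prim b y t) :=
              mul_le_mul e2 e1 (exp_pos _).le (by linarith)
            gcongr
        _ = _ := by ring
    · exact Continuous.intervalIntegrable (by fun_prop) _ _
  rw [intervalIntegral.integral_add (Continuous.intervalIntegrable (by fun_prop) _ _)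
    (Continuous.intervalIntegrable (by fun_prop) _ _), intervalIntegral.integral_const_mul,
    intervalIntegral.integral_const_mul, exp_prim_integral hb, integral_pow] at h1
  rw [abs_mul, abs_of_pos (exp_pos _)]
  have e : exp (-prim b y t) * exp (prim b y t) = 1 := by
    rw [← exp_add]; simp
  calc _ ≤ exp (-prim b y t) * _ := mul_le_mul_of_nonneg_left h1 (exp_pos _).le
    _ = G * (exp (-prim b y t) * exp (prim b y t) - exp (-prim b y t)) +
        (exp (-prim b y t) * exp (prim b y t)) * (K * c * (t ^ (n + 1) / (n + 1))) := by
          simp only [zero_pow (Nat.succ_ne_zero n), sub_zero]; ring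
    _ = _ := by rw [e]; ring

structure Mild (b g : ℝ → ℝ) (L G : ℝ) (u : ℝ → ℝ → ℝ) : Prop where
  hb : Continuous b
  b0 : ∀ z, 0 ≤ b z
  bK : ∀ Y, ∃ K, ∀ z ≤ Y, b z ≤ K
  hL : 0 ≤ L
  hg : Continuous g
  gG : ∀ y, |g y| ≤ G
  eq : ∀ t ≥ 0, ∀ y, u t y = exp (-prim b y t) *
    (g y + ∫ σ in (0:ℝ)..t, b (y - σ) * (exp (prim b y σ) * u σ (y - L)))
  loc : ∀ T Y, ∃ m, ∀ t, 0 ≤ t → t ≤ T → ∀ y ≤ Y, |u t y| ≤ exp (-y) * m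

section
variable {b g : ℝ → ℝ} {L G : ℝ} {u : ℝ → ℝ → ℝ}

lemma Mild.G0 (hm : Mild b g L G u) : 0 ≤ G := (abs_nonneg _).trans (hm.gG 0)

lemma Mild.bound_aux (hm : Mild b g L G u) {T Y K m : ℝ} (hK : ∀ z ≤ Y, b z ≤ K)
    (hmm : ∀ t, 0 ≤ t → t ≤ T → ∀ y ≤ Y, |u t y| ≤ exp (-y) * m) (hm0 : 0 ≤ m) (hK0 : 0 ≤ K)
    (n : ℕ) : ∀ t, 0 ≤ t → t ≤ T → ∀ y ≤ Y,
      |u t y| ≤ G + exp (-y) * m * (exp L * K * t) ^ n / n.factorial := by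
  induction n with
  | zero =>
    intro t h0 hT y hy
    have := hmm t h0 hT y hy
    have := hm.G0
    simp
    linarith
  | succ n ih =>
    intro t h0 hT y hy
    have hL := hm.hL
    have hgr := gron (F := fun σ => u σ (y - L)) (y := y) (t := t) (G := G)
      (c := exp (-y) * exp L * m * (exp L * K) ^ n / n.factorial) (K := K) (n := n) hm.hb hm.b0
      (fun z hz => hK z (hz.trans hy)) h0 (by positivity) (by
        intro σ h1 h2
        have := ih σ h1 (h2.trans hT) (y - L) (by linarith)
        refine this.trans (le_of_eq ?_)
        rw [show -(y - L) = -y + L by ring, exp_add, mul_pow _ σ]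
        ring)
    rw [hm.eq t h0 y, mul_add]
    have h1 : |exp (-prim b y t) * g y| ≤ exp (-prim b y t) * G := by
      rw [abs_mul, abs_of_pos (exp_pos _)]
      exact mul_le_mul_of_nonneg_left (hm.gG y) (exp_pos _).le
    refine (abs_add_le _ _).trans ?_
    have h2 : K * (exp (-y) * exp L * m * (exp L * K) ^ n / n.factorial) * t ^ (n + 1) / (n + 1)
        = exp (-y) * m * (exp L * K * t) ^ (n + 1) / (n + 1).factorial := by
      have hf : (n.factorial : ℝ) ≠ 0 := by positivity
      rw [Nat.factorial_succ]
      push_cast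
      field_simp
      ring
    rw [h2] at hgr
    linarith

lemma Mild.bound (hm : Mild b g L G u) {t : ℝ} (ht : 0 ≤ t) (y : ℝ) : |u t y| ≤ G := by
  obtain ⟨K, hK⟩ := hm.bK y
  obtain ⟨m, hmm⟩ := hm.loc t y
  have hm0 : 0 ≤ m := by
    have h := (abs_nonneg _).trans (hmm t ht le_rfl y le_rfl)
    exact nonneg_of_mul_nonneg_right h (exp_pos _)
  have hK0 : 0 ≤ K := (hm.b0 y).trans (hK y le_rfl)
  have hlim := (FloorSemiring.tendsto_pow_div_factorial_atTop (exp L * K * t)).const_mul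
    (exp (-y) * m)
  have hlim2 := hlim.const_add G
  simp only [mul_zero, add_zero] at hlim2
  refine ge_of_tendsto' hlim2 fun n => ?_
  have := hm.bound_aux hK hmm hm0 hK0 n t ht le_rfl y le_rfl
  rwa [mul_div_assoc] at this

lemma prim_meas (F : ℝ → ℝ) :
    AEStronglyMeasurable (fun t => ∫ σ in (0:ℝ)..t, F σ) (volume.restrict (Ici 0)) := by
  set S : Set ℝ := {t | 0 ≤ t ∧ IntervalIntegrable F volume 0 t} with hS
  have hmem : ∀ t ∈ S, ∀ s, 0 ≤ s → s ≤ t → s ∈ S := by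
    intro t ht s hs0 hst
    refine ⟨hs0, ht.2.mono_set ?_⟩
    rw [uIcc_of_le hs0, uIcc_of_le ht.1]
    exact Icc_subset_Icc_right hst
  have hord : S.OrdConnected := by
    refine ⟨fun a ha c hc s hs => ?_⟩
    exact hmem c hc s (ha.1.trans hs.1) hs.2
  have hSm : MeasurableSet S := hord.measurableSet
  have hprim : ∀ t ∈ S, ContinuousOn (fun t => ∫ σ in (0:ℝ)..t, F σ) (Icc 0 t) := by
    intro t ht
    have := intervalIntegral.continuousOn_primitive_interval' ht.2 (a := 0) (by simp)
    rwa [uIcc_of_le ht.1] at this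
  have hcont : ContinuousOn (fun t => ∫ σ in (0:ℝ)..t, F σ) S := by
    intro t ht
    by_cases h : ∃ t' ∈ S, t < t'
    · obtain ⟨t', ht', hlt⟩ := h
      have h1 := hprim t' ht' t ⟨ht.1, hlt.le⟩
      refine h1.mono_of_mem_nhdsWithin ?_
      have h2 : Iio t' ∈ 𝓝[S] t := mem_nhdsWithin_of_mem_nhds (Iio_mem_nhds hlt)
      filter_upwards [h2, self_mem_nhdsWithin] with s hs1 hs2
      exact ⟨hs2.1, le_of_lt hs1⟩
    · push Not at h
      exact (hprim t ht t ⟨ht.1, le_rfl⟩).mono fun s hs => ⟨hs.1, h s hs⟩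
  have hsub : Ici (0:ℝ) ⊆ S ∪ (Ici 0 \ S) := fun x hx => by
    by_cases h : x ∈ S
    · exact Or.inl h
    · exact Or.inr ⟨hx, h⟩
  refine AEStronglyMeasurable.mono_set hsub ?_
  rw [aestronglyMeasurable_union_iff]
  refine ⟨hcont.aestronglyMeasurable hSm, ?_⟩
  refine (aestronglyMeasurable_const (b := (0:ℝ))).congr ?_
  filter_upwards [ae_restrict_mem (measurableSet_Ici.diff hSm)] with t ht
  exact (intervalIntegral.integral_undef fun hh => ht.2 ⟨ht.1, hh⟩).symm

lemma Mild.meas (hm : Mild b g L G u) (y : ℝ) :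
    AEStronglyMeasurable (fun t => u t y) (volume.restrict (Ici 0)) := by
  have h1 := prim_meas (fun σ => b (y - σ) * (exp (prim b y σ) * u σ (y - L)))
  have hpc := prim_cont hm.hb y
  have h2 : Continuous (fun t => exp (-prim b y t)) := by fun_prop
  have h3 := h2.aestronglyMeasurable (μ := volume.restrict (Ici 0)) |>.mul
    ((aestronglyMeasurable_const (b := g y)).add h1)
  refine h3.congr ?_
  filter_upwards [ae_restrict_mem measurableSet_Ici] with t ht
  exact (hm.eq t ht y).symm

lemma Mild.intble (hm : Mild b g L G u) (y y' : ℝ) {t : ℝ} (ht : 0 ≤ t) :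
    IntervalIntegrable (fun σ => b (y - σ) * (exp (prim b y σ) * u σ y')) volume 0 t := by
  have hb := hm.hb
  have hpc := prim_cont hm.hb y
  have h1 : IntervalIntegrable (fun σ => u σ y') volume 0 t := by
    rw [intervalIntegrable_iff_integrableOn_Ioc_of_le ht]
    refine Integrable.of_bound (C := G) ?_ ?_
    · exact (hm.meas y').mono_set (fun x (hx : x ∈ Ioc 0 t) => hx.1.le)
    · filter_upwards [ae_restrict_mem measurableSet_Ioc] with s hs
      exact hm.bound hs.1.le y'
  have h2 : Continuous (fun σ => b (y - σ) * exp (prim b y σ)) := by fun_prop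
  have h3 := h1.continuousOn_mul h2.continuousOn
  refine h3.congr ?_
  intro σ _
  simp only
  ring

def pic (b g : ℝ → ℝ) (L : ℝ) : ℕ → ℝ → ℝ → ℝ
  | 0 => fun _ _ => 0
  | n + 1 => fun t y => exp (-prim b y t) *
    (g y + ∫ σ in (0:ℝ)..t, b (y - σ) * (exp (prim b y σ) * pic b g L n σ (y - L)))

lemma prim_cont2 (hb : Continuous b) : Continuous (fun p : ℝ × ℝ => prim b p.2 p.1) := by
  unfold prim
  have := intervalIntegral.continuous_parametric_intervalIntegral_of_continuous
    (μ := volume) (f := fun (p : ℝ × ℝ) s => b (p.2 - s)) (a₀ := 0) (s := fun p => p.1)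
    (by unfold Function.uncurry; fun_prop) continuous_fst
  exact this

lemma pic_cont (hb : Continuous b) (hg : Continuous g) (n : ℕ) :
    Continuous (fun p : ℝ × ℝ => pic b g L n p.1 p.2) := by
  induction n with
  | zero => simp only [pic]; exact continuous_const
  | succ n ih =>
    simp only [pic]
    have h1 := prim_cont2 hb
    have h2 : Continuous (fun q : (ℝ × ℝ) × ℝ => prim b q.1.2 q.2) :=
      h1.comp (f := fun q : (ℝ × ℝ) × ℝ => (q.2, q.1.2)) (by fun_prop)
    have h3 : Continuous (fun q : (ℝ × ℝ) × ℝ => pic b g L n q.2 (q.1.2 - L)) :=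
      ih.comp (f := fun q : (ℝ × ℝ) × ℝ => (q.2, q.1.2 - L)) (by fun_prop)
    have h4 := intervalIntegral.continuous_parametric_intervalIntegral_of_continuous
      (μ := volume) (f := fun (p : ℝ × ℝ) σ => b (p.2 - σ) *
        (exp (prim b p.2 σ) * pic b g L n σ (p.2 - L))) (a₀ := 0) (s := fun p => p.1)
      (by unfold Function.uncurry; fun_prop) continuous_fst
    exact (Real.continuous_exp.comp h1.neg).mul ((hg.comp continuous_snd).add h4)

lemma Mild.pic_close (hm : Mild b g L G u) {Y K : ℝ} (hK : ∀ z ≤ Y, b z ≤ K) (n : ℕ) :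
    ∀ t ≥ 0, ∀ y ≤ Y, |u t y - pic b g L n t y| ≤ G * (K * t) ^ n / n.factorial := by
  have hK0 : 0 ≤ K := (hm.b0 Y).trans (hK Y le_rfl)
  have hG := hm.G0
  have hL := hm.hL
  induction n with
  | zero =>
    intro t ht y hy
    simpa [pic] using hm.bound ht y
  | succ n ih =>
    intro t ht y hy
    have hb := hm.hb
    have hpc := prim_cont hm.hb y
    have hp : Continuous (fun σ => pic b g L n σ (y - L)) :=
      (pic_cont hm.hb hm.hg n).comp (f := fun σ => (σ, y - L)) (by fun_prop)
    have hgr := gron (F := fun σ => u σ (y - L) - pic b g L n σ (y - L)) (y := y) (t := t) (G := 0)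
      (c := G * K ^ n / n.factorial) (K := K) (n := n) hm.hb hm.b0
      (fun z hz => hK z (hz.trans hy)) ht (by positivity) (by
        intro σ h1 h2
        have := ih σ h1 (y - L) (by linarith)
        refine this.trans (le_of_eq ?_)
        rw [mul_pow]
        ring)
    have he : u t y - pic b g L (n + 1) t y = exp (-prim b y t) * ∫ σ in (0:ℝ)..t,
        b (y - σ) * (exp (prim b y σ) * (u σ (y - L) - pic b g L n σ (y - L))) := by
      rw [hm.eq t ht y]
      simp only [pic]
      rw [← mul_sub, add_sub_add_left_eq_sub, ← intervalIntegral.integral_sub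
        (hm.intble y (y - L) ht) (Continuous.intervalIntegrable (by fun_prop) _ _)]
      congr 2
      ext σ
      ring
    rw [he]
    refine hgr.trans (le_of_eq ?_)
    have hf : (n.factorial : ℝ) ≠ 0 := by positivity
    rw [Nat.factorial_succ]
    push_cast
    field_simp
    ring

lemma Mild.cont (hm : Mild b g L G u) :
    Continuous (fun p : ℝ × ℝ => u (max p.1 0) p.2) := by
  refine continuous_of_locally_uniform_approx_of_continuousAt fun x V hV => ?_
  obtain ⟨ε, hε, hεV⟩ := Metric.mem_uniformity_dist.1 hV
  set Y := x.2 + 1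
  set T := max x.1 0 + 1
  obtain ⟨K, hK⟩ := hm.bK Y
  have hK0 : 0 ≤ K := (hm.b0 Y).trans (hK Y le_rfl)
  have hG := hm.G0
  have hlim := (FloorSemiring.tendsto_pow_div_factorial_atTop (K * T)).const_mul G
  rw [mul_zero] at hlim
  obtain ⟨n, hn⟩ := (hlim.eventually (gt_mem_nhds hε)).exists
  refine ⟨{p | p.1 < x.1 + 1 ∧ p.2 < Y}, ?_, fun p => pic b g L n (max p.1 0) p.2, ?_, ?_⟩
  · have : IsOpen {p : ℝ × ℝ | p.1 < x.1 + 1 ∧ p.2 < Y} :=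
      (isOpen_lt continuous_fst continuous_const).inter
        (isOpen_lt continuous_snd continuous_const)
    exact this.mem_nhds ⟨by linarith, by simp [Y]⟩
  · exact ((pic_cont hm.hb hm.hg n).comp (f := fun p : ℝ × ℝ => (max p.1 0, p.2))
      (by fun_prop)).continuousAt
  · rintro p ⟨hp1, hp2⟩
    refine hεV ?_
    rw [Real.dist_eq]
    have hT : max p.1 0 ≤ T := by
      refine max_le ?_ ?_
      · have := le_max_left x.1 0
        simp only [T]; linarith
      · have := le_max_right x.1 0
        simp only [T]; linarith
    have h0 : 0 ≤ max p.1 0 := le_max_right _ _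
    refine (hm.pic_close hK n (max p.1 0) h0 p.2 hp2.le).trans_lt (lt_of_le_of_lt ?_ hn)
    rw [mul_div_assoc]
    gcongr

theorem Mild.sol (hm : Mild b g L G u) :
    Sol b L (fun t z => u (max t 0) (z + max t 0)) G := by
  have hcc := hm.cont
  refine ⟨?_, fun t z => hm.bound (le_max_right _ _) _, ?_⟩
  · exact hcc.comp (f := fun p : ℝ × ℝ => (p.1, p.2 + max p.1 0)) (by fun_prop)
  · intro t ht s hs y0
    set y := y0 + t with hy
    have hb := hm.hb
    have hpc := prim_cont hm.hb y
    have hv : Continuous (fun σ => u (max σ 0) (y - L)) :=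
      hcc.comp (f := fun σ => (σ, y - L)) (by fun_prop)
    have hw : Continuous (fun σ => u (max σ 0) y) :=
      hcc.comp (f := fun σ => (σ, y)) (by fun_prop)
    set q : ℝ → ℝ := fun r => exp (-prim b y r) * (g y + ∫ σ in (0:ℝ)..r,
      b (y - σ) * (exp (prim b y σ) * u (max σ 0) (y - L))) with hq
    have hqe : ∀ r ≥ 0, u r y = q r := by
      intro r hr
      rw [hm.eq r hr y]
      simp only [hq]
      congr 2
      refine intervalIntegral.integral_congr fun σ hσ => ?_
      rw [uIcc_of_le hr] at hσ
      simp only [max_eq_left hσ.1]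
    have hi : Continuous (fun σ => b (y - σ) * (exp (prim b y σ) * u (max σ 0) (y - L))) :=
      Continuous.mul (by fun_prop) (Continuous.mul (by fun_prop) hv)
    have hd : ∀ r, HasDerivAt q (b (y - r) * (u (max r 0) (y - L) - q r)) r := by
      intro r
      have h1 := ((prim_hasDeriv hb y r).neg).exp
      have h2 := (intervalIntegral.integral_hasDerivAt_right (hi.intervalIntegrable 0 r)
        (hi.stronglyMeasurableAtFilter _ _) hi.continuousAt).const_add (g y)
      have h3 := h1.mul h2
      refine h3.congr_deriv ?_
      have e : exp (-prim b y r) * exp (prim b y r) = 1 := by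
        rw [← exp_add]; simp
      simp only [hq]
      linear_combination (b (y - r) * u (max r 0) (y - L)) * e
    have hqc : Continuous q := continuous_iff_continuousAt.2 fun r => (hd r).continuousAt
    have hF := intervalIntegral.integral_eq_sub_of_hasDerivAt (a := t) (b := t + s)
      (fun r _ => hd r)
      (Continuous.intervalIntegrable (Continuous.mul (by fun_prop) (hv.sub hqc)) _ _)
    rw [← hqe t ht, ← hqe (t + s) (by positivity)] at hF
    have hsh := intervalIntegral.integral_comp_add_left (a := 0) (b := s)
      (fun r => b (y - r) * (u (max r 0) (y - L) - q r)) t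
    rw [add_zero, hF] at hsh
    simp only [max_eq_left ht, max_eq_left (show 0 ≤ t + s by positivity)]
    have e1 : y0 - s + (t + s) = y := by rw [hy]; ring
    rw [e1]
    have e2 : ∫ r in (0:ℝ)..s, b (y0 - r) * (u (max (t + r) 0) (y0 - r - L + max (t + r) 0)
        - u (max (t + r) 0) (y0 - r + max (t + r) 0)) = u (t + s) y - u t y := by
      rw [← hsh]
      refine intervalIntegral.integral_congr fun r hr => ?_
      rw [uIcc_of_le hs] at hr
      have hr0 : 0 ≤ t + r := by linarith [hr.1]
      simp only [max_eq_left hr0]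
      rw [← hqe (t + r) hr0]
      have e3 : y0 - r - L + (t + r) = y - L := by rw [hy]; ring
      have e4 : y0 - r + (t + r) = y := by rw [hy]; ring
      have e5 : y - (t + r) = y0 - r := by rw [hy]; ring
      rw [e3, e4, e5]
    rw [e2]
    ring

end

/-! ### Part 6: change of variables and supports -/

lemma exp_image_univ : Real.exp '' (univ : Set ℝ) = Ioi 0 := by
  rw [image_univ, Real.range_exp]

lemma cov_integrable (F : ℝ → ℝ) :
    IntegrableOn F (Ioi 0) ↔ Integrable (fun z => exp z * F (exp z)) := by
  have h := integrableOn_image_iff_integrableOn_abs_deriv_smul (s := univ) (f := Real.exp)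
    (f' := Real.exp) MeasurableSet.univ
    (fun x _ => (Real.hasDerivAt_exp x).hasDerivWithinAt) Real.exp_injective.injOn F
  rw [exp_image_univ, integrableOn_univ] at h
  simpa only [abs_of_pos (exp_pos _), smul_eq_mul] using h

lemma cov_integral (F : ℝ → ℝ) :
    ∫ x in Ioi (0:ℝ), F x = ∫ z, exp z * F (exp z) := by
  have h := integral_image_eq_integral_abs_deriv_smul (s := univ) (f := Real.exp)
    (f' := Real.exp) MeasurableSet.univ
    (fun x _ => (Real.hasDerivAt_exp x).hasDerivWithinAt) Real.exp_injective.injOn F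
  rw [exp_image_univ, Measure.restrict_univ] at h
  simpa only [abs_of_pos (exp_pos _), smul_eq_mul] using h

section
variable {b ρ : ℝ → ℝ} {L : ℝ}

lemma supp_pos (hb : Continuous b) (hρ0 : ∀ z, 0 ≤ ρ z) (hb0 : ∀ z, 0 ≤ b z)
    (hρ : ∀ z, HasDerivAt ρ (b (z + L) * ρ (z + L) - b z * ρ z) z)
    (hL : 0 < L) (hρ1 : ∫ z, ρ z = 1) (hS : IsUpperSet (closure {z | b z ≠ 0}))
    {z₀ : ℝ} (hz₀ : b z₀ ≠ 0) : 0 < b z₀ * ρ z₀ := by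
  have hρc : Continuous ρ := continuous_iff_continuousAt.2 fun z => (hρ z).continuousAt
  refine mul_pos (lt_of_le_of_ne (hb0 _) hz₀.symm) (lt_of_le_of_ne (hρ0 _) fun h0 => ?_)
  have hmono : Monotone (fun z => exp (∫ s in (0:ℝ)..z, b s) * ρ z) := by
    refine monotone_of_hasDerivAt_nonneg
      (f' := fun z => exp (∫ s in (0:ℝ)..z, b s) * (b (z + L) * ρ (z + L))) (fun z => ?_) ?_
    · have h1 := (intervalIntegral.integral_hasDerivAt_right (hb.intervalIntegrable 0 z)
        (hb.stronglyMeasurableAtFilter _ _) hb.continuousAt).exp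
      exact (h1.mul (hρ z)).congr_deriv (by ring)
    · intro z
      exact mul_nonneg (exp_pos _).le (mul_nonneg (hb0 _) (hρ0 _))
  have hdown : ∀ z w, w ≤ z → ρ z = 0 → ρ w = 0 := by
    intro z w hw hz
    have h := hmono hw
    simp only [hz, mul_zero] at h
    have : ρ w ≤ 0 := nonpos_of_mul_nonpos_right h (exp_pos _)
    exact le_antisymm this (hρ0 w)
  set Z := {z | ρ z = 0} with hZ
  have hZne : Z.Nonempty := ⟨z₀, h0.symm⟩
  have hZb : BddAbove Z := by
    by_contra hnb
    have : ∀ z, ρ z = 0 := by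
      intro z
      rw [not_bddAbove_iff] at hnb
      obtain ⟨w, hw, hzw⟩ := hnb z
      exact hdown w z hzw.le hw
    simp [this] at hρ1
  have hZc : IsClosed Z := isClosed_eq hρc continuous_const
  set a := sSup Z with ha
  have haZ : ρ a = 0 := hZc.csSup_mem hZne hZb
  have hz₀a : z₀ ≤ a := le_csSup hZb h0.symm
  have hbz : ∀ x ∈ Ioo a (a + L), b x = 0 := by
    intro x hx
    have hxa : x - L < a := by linarith [hx.2]
    have hev : ρ =ᶠ[𝓝 (x - L)] fun _ => 0 := by
      filter_upwards [Iio_mem_nhds hxa] with w hw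
      exact hdown a w (le_of_lt hw) haZ
    have hd0 : HasDerivAt ρ 0 (x - L) := (hasDerivAt_const (x - L) (0:ℝ)).congr_of_eventuallyEq hev
    have hd := (hρ (x - L)).unique hd0
    rw [hdown a (x - L) hxa.le haZ, sub_add_cancel, mul_zero, sub_zero] at hd
    rcases mul_eq_zero.1 hd with h | h
    · exact h
    · exact absurd (le_csSup hZb h) (not_le.2 hx.1)
  have hmem : a + L / 2 ∈ closure {z | b z ≠ 0} :=
    hS (by linarith : z₀ ≤ a + L / 2) (subset_closure hz₀)
  obtain ⟨w, hw1, hw2⟩ := mem_closure_iff.1 hmem (Ioo a (a + L)) isOpen_Ioo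
    ⟨by linarith, by linarith⟩
  exact hw2 (hbz w hw1)

lemma supp_all (hb : Continuous b) (hρ0 : ∀ z, 0 ≤ ρ z) (hb0 : ∀ z, 0 ≤ b z)
    (hρ : ∀ z, HasDerivAt ρ (b (z + L) * ρ (z + L) - b z * ρ z) z)
    (hρi : Integrable ρ)
    (hL : 0 < L) (hρ1 : ∫ z, ρ z = 1)
    (hS : closure {z | b z ≠ 0} = univ ∨ ∃ β, closure {z | b z ≠ 0} = Ici β) :
    (∀ z, b z ≠ 0 → z ∈ closure {z | 0 < b z * ρ z}) ∧
    (∀ z, ρ z ≠ 0 → ∀ x ≥ z, x + L ∈ closure {z | 0 < b z * ρ z}) ∧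
    (∀ z, ∃ z' ≥ z, (∀ x ∈ Icc z z', z < z' → b x = 0) ∧
      ∀ x ≥ z', x + L ∈ closure {z | 0 < b z * ρ z}) := by
  have hup : IsUpperSet (closure {z | b z ≠ 0}) := by
    rcases hS with h | ⟨β, h⟩
    · rw [h]; exact isUpperSet_univ
    · rw [h]; exact isUpperSet_Ici β
  have hsub : closure {z | b z ≠ 0} ⊆ closure {z | 0 < b z * ρ z} :=
    closure_mono fun z hz => supp_pos hb hρ0 hb0 hρ hL hρ1 hup hz
  refine ⟨fun z hz => hsub (subset_closure hz), ?_, ?_⟩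
  · intro z hz x hx
    apply hsub
    rcases hS with h | ⟨β, h⟩
    · rw [h]; trivial
    · rw [h]
      by_contra hlt
      have hlt' : x + L < β := not_le.1 hlt
      have hbz : ∀ w < β, b w = 0 := by
        intro w hw
        by_contra hne
        have : w ∈ Ici β := h ▸ subset_closure hne
        exact absurd hw (not_lt.2 this)
      have hconst : ∀ w ≤ z, ρ w = ρ z := by
        intro w hw
        refine (constant_of_has_deriv_right_zero (f := ρ) (a := w) (b := z)
          (fun v _ => (hρ v).continuousAt.continuousWithinAt) ?_ z ⟨hw, le_rfl⟩).symm
        intro v hv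
        have h1 := (hρ v).hasDerivWithinAt (s := Ici v)
        rw [hbz (v + L) (by linarith [hv.2]), hbz v (by linarith [hv.2])] at h1
        simpa using h1
      have hi : IntegrableOn (fun _ : ℝ => ρ z) (Iic z) := by
        refine hρi.integrableOn.congr_fun (fun w hw => hconst w hw) measurableSet_Iic
      rw [integrableOn_const_iff] at hi
      rcases hi with hi | hi
      · exact hz (by simpa using hi)
      · simp at hi
  · intro z
    rcases hS with h | ⟨β, h⟩
    · refine ⟨z, le_rfl, fun x _ hlt => absurd hlt (lt_irrefl _), fun x _ => hsub ?_⟩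
      rw [h]; trivial
    · refine ⟨max z (β - L), le_max_left _ _, ?_, ?_⟩
      · intro x hx hlt
        have h1 : z < β - L := by
          by_contra hc
          rw [max_eq_left (not_lt.1 hc)] at hlt
          exact lt_irrefl _ hlt
        rw [max_eq_right h1.le] at hx
        by_contra hne
        have h2 : x ∈ Ici β := h ▸ subset_closure hne
        have h3 : β ≤ x := h2
        linarith [hx.2]
      · intro x hx
        apply hsub
        rw [h]
        have := (le_max_right z (β - L)).trans hx
        change β ≤ x + L
        linarith

end

lemma bounded_of_tendsto {g : ℝ → ℝ} (hg : Continuous g) (h1 : Tendsto g atBot (𝓝 0))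
    (h2 : Tendsto g atTop (𝓝 0)) : ∃ G, ∀ y, |g y| ≤ G := by
  obtain ⟨a, ha⟩ := eventually_atBot.1 (h1.eventually (Metric.ball_mem_nhds 0 one_pos))
  obtain ⟨c, hc⟩ := eventually_atTop.1 (h2.eventually (Metric.ball_mem_nhds 0 one_pos))
  obtain ⟨C, hC⟩ := (isCompact_Icc (a := a) (b := c)).exists_bound_of_continuousOn hg.continuousOn
  refine ⟨max C 1, fun y => ?_⟩
  by_cases hya : y ≤ a
  · have := ha y hya
    rw [Real.dist_eq, sub_zero] at this
    exact le_max_of_le_right this.le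
  · by_cases hyc : c ≤ y
    · have := hc y hyc
      rw [Real.dist_eq, sub_zero] at this
      exact le_max_of_le_right this.le
    · exact le_max_of_le_left (hC y ⟨(not_le.1 hya).le, (not_le.1 hyc).le⟩)

section
variable {B U U' : ℝ → ℝ}

lemma bexp_cont (hB : ContinuousOn B (Ioi 0)) : Continuous (fun z => B (exp z)) :=
  hB.comp_continuous Real.continuous_exp fun z => exp_pos z

lemma bexp_bdd (hB : Bhyp B) (Y : ℝ) : ∃ K, ∀ z ≤ Y, B (exp z) ≤ K := by
  obtain ⟨hc, h0, ε, hε, C, hC⟩ := hB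
  obtain ⟨D, hD⟩ := (isCompact_Icc (a := log ε) (b := Y)).exists_bound_of_continuousOn
    (bexp_cont hc).continuousOn
  refine ⟨max C D, fun z hz => ?_⟩
  by_cases h : exp z < ε
  · exact le_max_of_le_left (hC _ (exp_pos z) h)
  · have h1 : log ε ≤ z := (Real.log_le_iff_le_exp hε).2 (not_lt.1 h)
    exact le_max_of_le_right ((le_abs_self _).trans (hD z ⟨h1, hz⟩))

lemma bexp_supp (hB2 : HypA2 B) : closure {z | B (exp z) ≠ 0} = univ ∨
    ∃ β, closure {z | B (exp z) ≠ 0} = Ici β := by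
  obtain ⟨-, ⟨b, hb0, hb⟩, -⟩ := hB2
  have h1 : closure {z | B (exp z) ≠ 0} = Real.exp ⁻¹' Ici b := by
    rw [Real.isOpenEmbedding_exp.isInducing.closure_eq_preimage_closure_image, ← hb]
    congr 2
    ext x
    constructor
    · rintro ⟨z, hz, rfl⟩
      exact ⟨exp_pos z, hz⟩
    · rintro ⟨hx, hx2⟩
      refine ⟨log x, ?_, exp_log hx⟩
      change B (exp (log x)) ≠ 0
      rwa [exp_log hx]
  rcases hb0.eq_or_lt with h | h
  · left
    rw [h1]
    ext z
    simp [← h, (exp_pos z).le]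
  · right
    refine ⟨log b, ?_⟩
    rw [h1]
    ext z
    exact (Real.log_le_iff_le_exp h).symm

lemma U_cont (hU : Perron B U U') : ContinuousOn U (Ioi 0) :=
  fun x hx => (hU.2.1 x hx).continuousAt.continuousWithinAt

lemma xU_int (hU : Perron B U U') : IntegrableOn (fun x => x * U x) (Ioi 0) := by
  have := (hU.2.2.2.2.2 1).2
  simpa using this

lemma BxU_int (hB : Bhyp B) (hB2 : HypA2 B) (hU : Perron B U U') :
    IntegrableOn (fun x => B x * (x * U x)) (Ioi 0) := by
  obtain ⟨-, -, -, b₁, hb₁, γ₁, -, γ₂, -, K₁, -, K₂, hK₂, hbd⟩ := hB2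
  obtain ⟨K, hK⟩ := bexp_bdd hB (log b₁)
  have hK0 : 0 ≤ K := (hB.2.1 _ (exp_pos (log b₁))).trans (hK _ le_rfl)
  have hi1 := (xU_int hU).const_mul K
  have hi2 := ((hU.2.2.2.2.2 (γ₂ + 1)).2).const_mul K₂
  refine Integrable.mono' (hi1.add hi2) ?_ ?_
  · exact (hB.1.mul (continuousOn_id.mul (U_cont hU))).aestronglyMeasurable measurableSet_Ioi
  · filter_upwards [ae_restrict_mem measurableSet_Ioi] with x hx
    have hx0 : (0:ℝ) < x := hx
    have hUx := hU.1 x hx0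
    have hBx : B x ≤ K + K₂ * x ^ γ₂ := by
      have hp : 0 ≤ x ^ γ₂ := (rpow_pos_of_pos hx0 _).le
      rcases le_or_gt x b₁ with h | h
      · have h3 := hK (log x) (log_le_log hx0 h)
        rw [exp_log hx0] at h3
        have : 0 ≤ K₂ * x ^ γ₂ := by positivity
        linarith
      · have := (hbd x h).2
        linarith
    rw [Real.norm_eq_abs, abs_of_nonneg (mul_nonneg (hB.2.1 x hx0) (mul_nonneg hx0.le hUx))]
    simp only [Pi.add_apply]
    rw [rpow_add hx0, rpow_one]
    calc B x * (x * U x) ≤ (K + K₂ * x ^ γ₂) * (x * U x) := by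
          have : 0 ≤ x * U x := mul_nonneg hx0.le hUx
          gcongr
      _ = _ := by ring

lemma exp_log_two (z : ℝ) : exp (z + log 2) = 2 * exp z := by
  rw [exp_add, exp_log (by norm_num : (0:ℝ) < 2)]; ring

lemma rho_deriv (hU : Perron B U U') (z : ℝ) :
    HasDerivAt (fun z => exp z * (exp z * U (exp z)))
      (B (exp (z + log 2)) * (exp (z + log 2) * (exp (z + log 2) * U (exp (z + log 2))))
        - B (exp z) * (exp z * (exp z * U (exp z)))) z := by
  have h1 := Real.hasDerivAt_exp z
  have h2 : HasDerivAt (fun z => U (exp z)) (U' (exp z) * exp z) z :=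
    (hU.2.1 (exp z) (exp_pos z)).comp z h1
  refine (h1.mul (h1.mul h2)).congr_deriv ?_
  have h3 := hU.2.2.2.1 (exp z) (exp_pos z)
  rw [exp_log_two, Pi.mul_apply]
  linear_combination (exp z) ^ 2 * h3

lemma mild_of_M {M : ℝ → ℝ → ℝ} {f : ℝ → ℝ} {G : ℝ} (hB : Bhyp B)
    (hgc : Continuous (fun z => f (exp z) * exp (-z)))
    (hG : ∀ z, |f (exp z) * exp (-z)| ≤ G) (h1 : LocBdd2 M) (h2 : IsMildSol B f M) :
    Mild (fun z => B (exp z)) (fun z => f (exp z) * exp (-z)) (log 2) G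
      (fun t y => M t (exp (y - t)) * exp (-y)) := by
  have hbc := bexp_cont hB.1
  refine ⟨hbc, fun z => hB.2.1 _ (exp_pos z), bexp_bdd hB, (log_pos (by norm_num)).le,
    hgc, hG, ?_, ?_⟩
  · intro t ht y
    rw [h2 t ht (exp (y - t)) (exp_pos _)]
    have hA : ∀ τ, ∫ s in (0:ℝ)..τ, B (exp (y - t) * exp s) =
        prim (fun z => B (exp z)) y t - prim (fun z => B (exp z)) y (t - τ) := by
      intro τ
      have hc : Continuous (fun s => B (exp (y - s))) :=
        hbc.comp (f := fun s => y - s) (by fun_prop)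
      unfold prim
      rw [intervalIntegral.integral_interval_sub_left (hc.intervalIntegrable _ _)
        (hc.intervalIntegrable _ _)]
      have h3 := intervalIntegral.integral_comp_sub_left (a := 0) (b := τ)
        (fun s => B (exp (y - s))) t
      rw [sub_zero] at h3
      rw [← h3]
      congr 1
      ext s
      rw [← exp_add]
      congr 2
      ring
    have hsub := intervalIntegral.integral_comp_sub_left (a := 0) (b := t)
      (fun σ => B (exp (y - σ)) * (exp (prim (fun z => B (exp z)) y σ) *
        (M σ (exp (y - log 2 - σ)) * exp (-(y - log 2))))) t
    rw [sub_zero, sub_self] at hsub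
    rw [← hsub]
    set P := prim (fun z => B (exp z)) y with hP
    simp only [hA, sub_self]
    rw [show P 0 = 0 from prim_zero _ _, sub_zero, ← exp_add, sub_add_cancel, add_mul, mul_add]
    congr 1
    · ring
    · rw [← intervalIntegral.integral_const_mul, ← intervalIntegral.integral_const_mul,
        ← intervalIntegral.integral_mul_const]
      congr 1
      ext τ
      have e1 : exp (y - t) * exp τ = exp (y - (t - τ)) := by
        rw [← exp_add]; congr 1; ring
      have e2 : exp (y - (t - τ)) / 2 = exp (y - log 2 - (t - τ)) := by
        rw [show y - log 2 - (t - τ) = y - (t - τ) - log 2 by ring, exp_sub _ (log 2),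
          exp_log (by norm_num : (0:ℝ) < 2)]
      have e3 : exp (-(y - log 2)) = 2 * exp (-y) := by
        rw [← exp_log_two]; congr 1; ring
      have e4 : exp (-(P t - P (t - τ))) = exp (-P t) * exp (P (t - τ)) := by
        rw [← exp_add]; congr 1; ring
      rw [e1, e2, e3, e4]
      ring
  · intro T Y
    obtain ⟨C, hC⟩ := h1 (max T (exp Y) ) (lt_max_of_lt_right (exp_pos Y))
    refine ⟨C, fun t ht0 htT y hy => ?_⟩
    rw [abs_mul, abs_of_pos (exp_pos _), mul_comm]
    refine mul_le_mul_of_nonneg_left (hC t _ ht0 (htT.trans (le_max_left _ _)) (exp_pos _) ?_)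
      (exp_pos _).le
    exact (exp_le_exp.2 (by linarith)).trans (le_max_right _ _)

end
/-- Mean ergodicity: for `f ∈ Ċ₀`, both `(1/log 2)∫_t^{t+log 2} e^{-s} M_s f ds` and
`(1/t)∫₀^t e^{-s} M_s f ds` converge locally uniformly on `(0,∞)`, as `t → ∞`, to
`x ↦ (∫₀^∞ f U) · x`. -/
theorem stmt17 (B : ℝ → ℝ) (hB : Bhyp B) (hB2 : HypA2 B)
    (U U' : ℝ → ℝ) (hU : Perron B U U')
    (M : (ℝ → ℝ) → ℝ → ℝ → ℝ)
    (hM : ∀ g, LocBddOn g → LocBdd2 (M g) ∧ IsMildSol B g (M g))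
    (f : ℝ → ℝ) (hfc : ContinuousOn f (Ioi 0))
    (h0 : Tendsto (fun x => f x / x) (nhdsWithin 0 (Ioi 0)) (nhds 0))
    (hinf : Tendsto (fun x => f x / x) atTop (nhds 0)) :
    ∀ K : Set ℝ, IsCompact K → K ⊆ Ioi 0 → ∀ ε > 0, ∃ T, ∀ t ≥ T, ∀ x ∈ K,
      |(1 / Real.log 2) * (∫ s in t..(t + Real.log 2), exp (-s) * M f s x)
          - (∫ y in Ioi 0, f y * U y) * x| ≤ ε ∧
      |(1 / t) * (∫ s in (0:ℝ)..t, exp (-s) * M f s x)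
          - (∫ y in Ioi 0, f y * U y) * x| ≤ ε := by
  have hL : 0 < log 2 := log_pos (by norm_num)
  set b : ℝ → ℝ := fun z => B (exp z) with hbdef
  set ρ : ℝ → ℝ := fun z => exp z * (exp z * U (exp z)) with hρdef
  set g : ℝ → ℝ := fun z => f (exp z) * exp (-z) with hgdef
  have hbc : Continuous b := bexp_cont hB.1
  have hb0 : ∀ z, 0 ≤ b z := fun z => hB.2.1 _ (exp_pos z)
  have hgc : Continuous g := by
    have : Continuous (fun z => f (exp z)) :=
      hfc.comp_continuous Real.continuous_exp fun z => exp_pos z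
    exact this.mul (by fun_prop)
  have hge : ∀ z, f (exp z) / exp z = g z := fun z => by
    rw [hgdef]; simp only [exp_neg, div_eq_mul_inv]
  have hg1 : Tendsto g atBot (𝓝 0) :=
    (h0.comp Real.tendsto_exp_atBot_nhdsGT).congr hge
  have hg2 : Tendsto g atTop (𝓝 0) :=
    (hinf.comp Real.tendsto_exp_atTop).congr hge
  obtain ⟨G, hG⟩ := bounded_of_tendsto hgc hg1 hg2
  have hG0 : 0 ≤ G := (abs_nonneg _).trans (hG 0)
  have hlb : LocBddOn f := by
    intro r hr
    refine ⟨G * r, fun x hx hxr => ?_⟩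
    have h1 := hG (log x)
    rw [← hge, exp_log hx, abs_div, abs_of_pos hx, div_le_iff₀ hx] at h1
    exact h1.trans (mul_le_mul_of_nonneg_left hxr hG0)
  obtain ⟨hM1, hM2⟩ := hM f hlb
  have hmild := mild_of_M hB hgc hG hM1 hM2
  have hsol := hmild.sol
  set h : ℝ → ℝ → ℝ := fun t z =>
    M f (max t 0) (exp (z + max t 0 - max t 0)) * exp (-(z + max t 0)) with hhdef
  have hρ0 : ∀ z, 0 ≤ ρ z := fun z =>
    mul_nonneg (exp_pos _).le (mul_nonneg (exp_pos _).le (hU.1 _ (exp_pos z)))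
  have hρi : Integrable ρ := (cov_integrable _).1 (xU_int hU)
  have hρ1 : ∫ z, ρ z = 1 := by
    rw [← hU.2.2.2.2.1, cov_integral]
  have hbρ : Integrable (fun z => b z * ρ z) := by
    refine ((cov_integrable _).1 (BxU_int hB hB2 hU)).congr (Eventually.of_forall fun z => ?_)
    simp only [hbdef, hρdef]
    ring
  have hρd := rho_deriv hU
  obtain ⟨H1, H2, H3⟩ := supp_all hbc hρ0 hb0 hρd hρi hL hρ1 (bexp_supp hB2)
  have hm0 : ∫ z, h 0 z * ρ z = ∫ y in Ioi 0, f y * U y := by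
    rw [cov_integral]
    congr 1
    ext z
    have e := hmild.eq 0 le_rfl z
    simp only [prim_zero, neg_zero, exp_zero, one_mul, intervalIntegral.integral_same,
      add_zero, sub_zero] at e
    have e2 : h 0 z = f (exp z) * exp (-z) := by
      rw [← e]
      simp [hhdef]
    rw [e2, hρdef]
    have e3 : exp (-z) * exp z = 1 := by rw [← exp_add]; simp
    linear_combination (f (exp z) * exp z * U (exp z)) * e3
  set m := ∫ y in Ioi 0, f y * U y with hm
  have hrel : ∀ s ≥ 0, ∀ x > 0, exp (-s) * M f s x = x * h s (log x) := by
    intro s hs x hx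
    simp only [hhdef, max_eq_left hs, add_sub_cancel_right, exp_log hx]
    rw [neg_add, exp_add, exp_neg (log x), exp_log hx]
    field_simp
  intro K hK hK0 ε hε
  have hlogK : IsCompact (log '' K) :=
    hK.image_of_continuousOn (continuousOn_log.mono fun x hx => (hK0 hx).ne')
  obtain ⟨R, hR⟩ := hK.exists_bound_of_continuousOn (f := fun x : ℝ => x) continuousOn_id
  set R' := max R 1 with hR'
  have hR0 : 0 < R' := lt_max_of_lt_right one_pos
  have hη : 0 < ε / R' := by positivity
  have hcore : ∀ η > 0, ∃ T, ∀ t ≥ T, ∀ z ∈ log '' K, |avg (log 2) h t z - m| ≤ η := by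
    intro η hη
    rw [← hm0]
    exact hsol.core hbc hb0 hρ0 hρd hρi hbρ hL hρ1 H1 H2 H3 hlogK hη
  obtain ⟨T1, hT1⟩ := hcore _ hη
  obtain ⟨T2, hT2⟩ := cesaro hL hsol.cont hsol.bdd hcore hη
  have hfin : ∀ x ∈ K, ∀ a c : ℝ, a = x * c → |c - m| ≤ ε / R' → |a - m * x| ≤ ε := by
    rintro x hx a c rfl hc
    have hx0 : 0 < x := hK0 hx
    have hxR : x ≤ R' := by
      have := hR x hx
      rw [Real.norm_eq_abs, abs_of_pos hx0] at this
      exact this.trans (le_max_left _ _)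
    rw [show x * c - m * x = x * (c - m) by ring, abs_mul, abs_of_pos hx0]
    calc x * |c - m| ≤ R' * (ε / R') := by gcongr
      _ = ε := by field_simp
  refine ⟨max (max T1 T2) 0, fun t ht x hx => ?_⟩
  have ht0 : 0 ≤ t := (le_max_right _ _).trans ht
  have ht1 : T1 ≤ t := ((le_max_left _ _).trans (le_max_left _ _)).trans ht
  have ht2 : T2 ≤ t := ((le_max_right _ _).trans (le_max_left _ _)).trans ht
  have hx0 : 0 < x := hK0 hx
  have hxl : log x ∈ log '' K := ⟨x, hx, rfl⟩
  constructor
  · refine hfin x hx _ _ ?_ (hT1 t ht1 (log x) hxl)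
    have e1 : ∫ s in t..(t + log 2), exp (-s) * M f s x =
        ∫ s in t..(t + log 2), x * h s (log x) := by
      refine intervalIntegral.integral_congr fun s hs => ?_
      rw [uIcc_of_le (by linarith)] at hs
      exact hrel s (ht0.trans hs.1) x hx0
    have e2 := intervalIntegral.integral_comp_add_left (a := 0) (b := log 2)
      (fun s => h s (log x)) t
    rw [add_zero] at e2
    rw [e1, intervalIntegral.integral_const_mul, avg, e2]
    ring
  · refine hfin x hx _ _ ?_ (hT2 t ht2 (log x) hxl)
    have e1 : ∫ s in (0:ℝ)..t, exp (-s) * M f s x = ∫ s in (0:ℝ)..t, x * h s (log x) := by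
      refine intervalIntegral.integral_congr fun s hs => ?_
      rw [uIcc_of_le ht0] at hs
      exact hrel s hs.1 x hx0
    rw [e1, intervalIntegral.integral_const_mul]
    ring
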